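/- arXiv:1709.01982 — 2 statements merged into one kernel-verified Lean document; each statement's English description precedes it below -/
import Mathlib

section
/- Every weighted graph G = (V,E) with edge weights w : E → ℝ≥0 admits a vertex-stabilizer S of cardinality exactly γ(G) (hence of minimum cardinality) which moreover satisfies ν(G∖S) ≥ (2/3)·ν(G). -/
namespace Stabilizer

variable {V : Type*} [Fintype V] [DecidableEq V]

/-- The set of vertices covered by a finite set of edges. -/
def edgeVerts (C : Finset (Sym2 V)) : Set V := {v | ∃ e ∈ C, v ∈ e}

/-- A matching of `G`, given as a finite set of pairwise vertex-disjoint edges. -/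
def IsMatching (G : SimpleGraph V) (M : Finset (Sym2 V)) : Prop :=
  (↑M ⊆ G.edgeSet) ∧ ∀ e ∈ M, ∀ f ∈ M, e ≠ f → ∀ v : V, v ∈ e → v ∉ f

/-- The total weight of a finite set of edges. -/
noncomputable def setWeight (w : Sym2 V → ℝ) (M : Finset (Sym2 V)) : ℝ := ∑ e ∈ M, w e

/-- ν(G): the maximum weight of a matching of `G`. -/
noncomputable def nu (G : SimpleGraph V) (w : Sym2 V → ℝ) : ℝ :=
  sSup {r : ℝ | ∃ M : Finset (Sym2 V), IsMatching G M ∧ r = setWeight w M}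

/-- A fractional matching of `G`. -/
def IsFracMatching (G : SimpleGraph V) (x : Sym2 V → ℝ) : Prop :=
  (∀ e, 0 ≤ x e) ∧ (∀ e, e ∉ G.edgeSet → x e = 0) ∧ ∀ v : V, ∑ u : V, x s(v, u) ≤ 1

/-- The weight of a fractional matching. -/
noncomputable def fracWeight (w x : Sym2 V → ℝ) : ℝ := ∑ e : Sym2 V, w e * x e

/-- ν_f(G): the maximum weight of a fractional matching of `G`. -/
noncomputable def nuf (G : SimpleGraph V) (w : Sym2 V → ℝ) : ℝ :=
  sSup {r : ℝ | ∃ x : Sym2 V → ℝ, IsFracMatching G x ∧ r = fracWeight w x}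

/-- A maximum-weight fractional matching of `G`. -/
def IsMaxFracMatching (G : SimpleGraph V) (w x : Sym2 V → ℝ) : Prop :=
  IsFracMatching G x ∧ ∀ y : Sym2 V → ℝ, IsFracMatching G y → fracWeight w y ≤ fracWeight w x

/-- All entries lie in {0, 1/2, 1}. -/
def IsHalfIntegral (x : Sym2 V → ℝ) : Prop := ∀ e, x e = 0 ∨ x e = 1 / 2 ∨ x e = 1

/-- `C` is the edge set of an odd cycle of `G`. -/
def IsOddCycleEdgeSet (G : SimpleGraph V) (C : Finset (Sym2 V)) : Prop :=
  ∃ (v : V) (c : G.Walk v v), c.IsCycle ∧ Odd c.length ∧ c.edges.toFinset = C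

/-- `F` is the family 𝒞(x) of vertex-disjoint odd cycles carrying exactly the
half-valued edges of `x`. -/
def IsCycleFamily (G : SimpleGraph V) (x : Sym2 V → ℝ) (F : Finset (Finset (Sym2 V))) : Prop :=
  (∀ C ∈ F, IsOddCycleEdgeSet G C) ∧
  (∀ C ∈ F, ∀ D ∈ F, C ≠ D → Disjoint (edgeVerts C) (edgeVerts D)) ∧
  (∀ e : Sym2 V, x e = 1 / 2 ↔ ∃ C ∈ F, e ∈ C)

/-- A basic fractional matching of `G`. -/
def IsBasic (G : SimpleGraph V) (x : Sym2 V → ℝ) : Prop :=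
  IsFracMatching G x ∧ IsHalfIntegral x ∧ ∃ F, IsCycleFamily G x F

/-- γ(G): the minimum number of odd cycles in the support of a basic
maximum-weight fractional matching of `G`. -/
noncomputable def gamma (G : SimpleGraph V) (w : Sym2 V → ℝ) : ℕ :=
  sInf {n : ℕ | ∃ (x : Sym2 V → ℝ) (F : Finset (Finset (Sym2 V))),
    IsMaxFracMatching G w x ∧ IsHalfIntegral x ∧ IsCycleFamily G x F ∧ F.card = n}

/-- `G` is stable: ν(G) = ν_f(G). -/
def IsStable (G : SimpleGraph V) (w : Sym2 V → ℝ) : Prop := nu G w = nuf G w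

/-- Deletion of a set of vertices (as the spanning subgraph obtained by
removing all edges incident to `S`; matchings, fractional matchings and covers
of `G∖S` correspond to those of this graph). -/
def deleteVerts (G : SimpleGraph V) (S : Set V) : SimpleGraph V where
  Adj a b := G.Adj a b ∧ a ∉ S ∧ b ∉ S
  symm := ⟨fun _ _ h => ⟨h.1.symm, h.2.2, h.2.1⟩⟩
  loopless := ⟨fun a h => G.loopless.irrefl a h.1⟩

/-- A fractional w-vertex cover of `G`. -/
def IsFracCover (G : SimpleGraph V) (w : Sym2 V → ℝ) (y : V → ℝ) : Prop :=
  (∀ v, 0 ≤ y v) ∧ ∀ a b : V, G.Adj a b → w s(a, b) ≤ y a + y b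

noncomputable def coverValue (y : V → ℝ) : ℝ := ∑ v : V, y v

/-- A minimum fractional w-vertex cover of `G`. -/
def IsMinFracCover (G : SimpleGraph V) (w : Sym2 V → ℝ) (y : V → ℝ) : Prop :=
  IsFracCover G w y ∧ ∀ z : V → ℝ, IsFracCover G w z → coverValue y ≤ coverValue z

/-- M(x): the 1-valued edges of `x`. -/
noncomputable def oneEdges (x : Sym2 V → ℝ) : Finset (Sym2 V) :=
  Finset.univ.filter fun e => x e = 1

/-- `v` is exposed by the matching `M`. -/
def MExposed (M : Finset (Sym2 V)) (v : V) : Prop := ∀ e ∈ M, v ∉ e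

/-- A list of edges alternately in and out of `M`. -/
def AltList (M : Finset (Sym2 V)) (l : List (Sym2 V)) : Prop :=
  l.Chain' fun e f => (e ∈ M ↔ f ∉ M)

variable {G : SimpleGraph V}

/-- An M-alternating walk. -/
def IsAltWalk (M : Finset (Sym2 V)) {a b : V} (p : G.Walk a b) : Prop := AltList M p.edges

/-- A valid walk: it starts (resp. ends) with an M-exposed vertex or an edge of `M`. -/
def IsValidWalk (M : Finset (Sym2 V)) {a b : V} (p : G.Walk a b) : Prop :=
  (MExposed M a ∨ ∃ e ∈ M, p.edges.head? = some e) ∧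
  (MExposed M b ∨ ∃ e ∈ M, p.edges.getLast? = some e)

/-- w(P ∩ M), with multiplicity. -/
noncomputable def wIn (w : Sym2 V → ℝ) (M : Finset (Sym2 V)) (l : List (Sym2 V)) : ℝ :=
  (l.map fun e => if e ∈ M then w e else 0).sum

/-- w(P ∖ M), with multiplicity. -/
noncomputable def wOut (w : Sym2 V → ℝ) (M : Finset (Sym2 V)) (l : List (Sym2 V)) : ℝ :=
  (l.map fun e => if e ∈ M then 0 else w e).sum

/-- An M-augmenting walk. -/
def IsAugWalk (w : Sym2 V → ℝ) (M : Finset (Sym2 V)) {a b : V} (p : G.Walk a b) : Prop :=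
  IsAltWalk M p ∧ IsValidWalk M p ∧ wIn w M p.edges < wOut w M p.edges

/-- An M-augmenting path. -/
def IsAugPath (w : Sym2 V → ℝ) (M : Finset (Sym2 V)) {a b : V} (p : G.Walk a b) : Prop :=
  p.IsPath ∧ IsAugWalk w M p

/-- An M-alternating cycle (an even cycle alternately in and out of `M`). -/
def IsAltCycle (M : Finset (Sym2 V)) {a : V} (c : G.Walk a a) : Prop :=
  c.IsCycle ∧ Even c.length ∧ AltList M c.edges ∧
  ∀ e f : Sym2 V, c.edges.head? = some e → c.edges.getLast? = some f → (e ∈ M ↔ f ∉ M)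

/-- An M-augmenting cycle. -/
def IsAugCycle (w : Sym2 V → ℝ) (M : Finset (Sym2 V)) {a : V} (c : G.Walk a a) : Prop :=
  IsAltCycle M c ∧ wIn w M c.edges < wOut w M c.edges

/-- An M-blossom with base `a` (traversed starting and ending at its base). -/
def IsBlossom (M : Finset (Sym2 V)) {a : V} (c : G.Walk a a) : Prop :=
  c.IsCycle ∧ Odd c.length ∧ AltList M c.edges ∧
  ∀ e : Sym2 V, c.edges.head? = some e → e ∉ M

/-- An M-flower: an M-blossom `c` with base `a` together with a valid M-alternating
path `p` from the base `a` to the root `r`, starting with an edge of `M`. -/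
def IsFlower (M : Finset (Sym2 V)) {a r : V} (c : G.Walk a a) (p : G.Walk a r) : Prop :=
  IsBlossom M c ∧ p.IsPath ∧ AltList M p.edges ∧
  (∃ e ∈ M, p.edges.head? = some e) ∧
  (MExposed M r ∨ ∃ e ∈ M, p.edges.getLast? = some e)

/-- An M-augmenting flower (with root `r`). -/
def IsAugFlower (w : Sym2 V → ℝ) (M : Finset (Sym2 V)) {a r : V}
    (c : G.Walk a a) (p : G.Walk a r) : Prop :=
  IsFlower M c p ∧
  wIn w M c.edges + 2 * wIn w M p.edges < wOut w M c.edges + 2 * wOut w M p.edges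

/-- An M-bi-cycle: two M-blossoms `c`, `d` with bases `a`, `b` joined by an odd
M-alternating path `p` starting and ending with edges of `M`. -/
def IsBicycle (M : Finset (Sym2 V)) {a b : V}
    (c : G.Walk a a) (p : G.Walk a b) (d : G.Walk b b) : Prop :=
  IsBlossom M c ∧ IsBlossom M d ∧ p.IsPath ∧ Odd p.length ∧ AltList M p.edges ∧
  (∃ e ∈ M, p.edges.head? = some e) ∧ (∃ e ∈ M, p.edges.getLast? = some e)

/-- An M-augmenting bi-cycle. -/
def IsAugBicycle (w : Sym2 V → ℝ) (M : Finset (Sym2 V)) {a b : V}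
    (c : G.Walk a a) (p : G.Walk a b) (d : G.Walk b b) : Prop :=
  IsBicycle M c p d ∧
  wIn w M c.edges + 2 * wIn w M p.edges + wIn w M d.edges <
    wOut w M c.edges + 2 * wOut w M p.edges + wOut w M d.edges

/-- All edges of the walk are tight with respect to the fractional vertex cover `y`. -/
def IsTightWalk (w : Sym2 V → ℝ) (y : V → ℝ) {a b : V} (p : G.Walk a b) : Prop :=
  ∀ d ∈ p.darts, y d.toProd.1 + y d.toProd.2 = w s(d.toProd.1, d.toProd.2)

/-- `x'` is the result of alternate rounding on the odd cycle with edge set `C`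
at the vertex `u`: on `C` it is 0/1-valued, both edges of `C` at `u` get value 0,
and its 1-valued edges inside `C` perfectly match the remaining vertices of `C`. -/
def AltRoundedOn (x' : Sym2 V → ℝ) (C : Finset (Sym2 V)) (u : V) : Prop :=
  (∀ e ∈ C, x' e = 0 ∨ x' e = 1) ∧ (∀ e ∈ C, u ∈ e → x' e = 0) ∧
  ∀ z ∈ edgeVerts C, z ≠ u → ∃! e : Sym2 V, e ∈ C ∧ x' e = 1 ∧ z ∈ e


/-- Summing over ordered pairs counts every non-diagonal unordered pair twice. -/
theorem sum_sum_sym2 (f : Sym2 V → ℝ)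
    (hf : ∀ v, f s(v, v) = 0) : ∑ v, ∑ u, f s(v, u) = 2 * ∑ e, f e := by
  rw [← Fintype.sum_prod_type' (f := fun v u => f s(v, u)),
    ← Finset.sum_fiberwise (s := Finset.univ) (g := fun p : V × V => s(p.1, p.2)), Finset.mul_sum]
  refine Finset.sum_congr rfl fun e _ => ?_
  rw [Finset.sum_congr rfl (g := fun _ => f e)
    (fun p hp => by rw [(Finset.mem_filter.mp hp).2])]
  induction e with
  | _ a b =>
    by_cases hab : a = b
    · subst hab; simp [hf]
    · have : (Finset.univ.filter fun p : V × V => s(p.1, p.2) = s(a, b)) = {(a, b), (b, a)} := by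
        ext ⟨p, q⟩; simp
      rw [this, Finset.sum_pair (by simp [hab])]; ring

theorem slack_identity (w x : Sym2 V → ℝ) (y : V → ℝ)
    (hx : ∀ v, x s(v, v) = 0) :
    ∑ v, ∑ u, (y v + y u - w s(v, u)) * x s(v, u) =
      2 * (∑ v, y v * ∑ u, x s(v, u) - fracWeight w x) := by
  have h1 := sum_sum_sym2 (fun e => w e * x e) (by simp [hx])
  have h2 : ∑ v, ∑ u, y u * x s(v, u) = ∑ v, ∑ u, y v * x s(v, u) := by
    rw [Finset.sum_comm]
    simp only [Sym2.eq_swap]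
  have h3 : ∑ v, y v * ∑ u, x s(v, u) = ∑ v, ∑ u, y v * x s(v, u) := by
    simp only [Finset.mul_sum]
  simp only [sub_mul, add_mul, Finset.sum_sub_distrib, Finset.sum_add_distrib, h1, h2, h3,
    fracWeight]
  ring

section Duality

set_option linter.unusedSectionVars false

variable {w x : Sym2 V → ℝ} {y : V → ℝ}

theorem IsFracMatching.diag (hx : IsFracMatching G x) (v : V) : x s(v, v) = 0 :=
  hx.2.1 _ (by simp)

theorem slack_nonneg (hx : IsFracMatching G x) (hy : IsFracCover G w y) (v u : V) :
    0 ≤ (y v + y u - w s(v, u)) * x s(v, u) := by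
  by_cases h : G.Adj v u
  · exact mul_nonneg (sub_nonneg.2 (hy.2 v u h)) (hx.1 _)
  · rw [hx.2.1 _ (by simpa using h)]; simp

theorem fracWeight_le_sum_mul (hx : IsFracMatching G x) (hy : IsFracCover G w y) :
    fracWeight w x ≤ ∑ v, y v * ∑ u, x s(v, u) := by
  have h := slack_identity w x y hx.diag
  have : 0 ≤ ∑ v, ∑ u, (y v + y u - w s(v, u)) * x s(v, u) :=
    Finset.sum_nonneg fun v _ => Finset.sum_nonneg fun u _ => slack_nonneg hx hy v u
  linarith

theorem fracWeight_le_coverValue (hx : IsFracMatching G x) (hy : IsFracCover G w y) :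
    fracWeight w x ≤ coverValue y :=
  (fracWeight_le_sum_mul hx hy).trans <| Finset.sum_le_sum fun v _ =>
    mul_le_of_le_one_right (hy.1 v) (hx.2.2 v)

/-- Complementary slackness. -/
theorem complementary_slackness (hx : IsFracMatching G x) (hy : IsFracCover G w y)
    (h : coverValue y ≤ fracWeight w x) :
    (∀ u v, x s(u, v) ≠ 0 → w s(u, v) = y u + y v) ∧
      ∀ v, y v ≠ 0 → ∑ u, x s(v, u) = 1 := by
  have h1 := fracWeight_le_sum_mul hx hy
  have h2 : ∀ v ∈ Finset.univ, y v * ∑ u, x s(v, u) ≤ y v := fun v _ =>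
    mul_le_of_le_one_right (hy.1 v) (hx.2.2 v)
  have h3 := Finset.sum_le_sum h2
  have h4 : ∑ v, y v * ∑ u, x s(v, u) = ∑ v, y v := le_antisymm h3 (h.trans h1)
  constructor
  · intro u v huv
    have h5 := slack_identity w x y hx.diag
    have h6 : ∑ v, ∑ u, (y v + y u - w s(v, u)) * x s(v, u) = 0 := by
      refine le_antisymm ?_
        (Finset.sum_nonneg fun v _ => Finset.sum_nonneg fun u _ => slack_nonneg hx hy v u)
      have : coverValue y = ∑ v, y v := rfl
      linarith
    rw [Finset.sum_eq_zero_iff_of_nonneg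
      (fun v _ => Finset.sum_nonneg fun u _ => slack_nonneg hx hy v u)] at h6
    have h7 := h6 u (Finset.mem_univ u)
    rw [Finset.sum_eq_zero_iff_of_nonneg (fun u' _ => slack_nonneg hx hy u u')] at h7
    have h8 := (mul_eq_zero.1 (h7 v (Finset.mem_univ v))).resolve_right huv
    linarith
  · intro v hv
    have := (Finset.sum_eq_sum_iff_of_le h2).1 h4 v (Finset.mem_univ v)
    exact mul_left_cancel₀ hv (by rw [this, mul_one])

theorem exists_fracCover (G : SimpleGraph V) (hw : ∀ e, 0 ≤ w e) : ∃ y, IsFracCover G w y :=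
  ⟨fun _ => ∑ e, w e, fun _ => Finset.sum_nonneg fun e _ => hw e, fun a b _ => by
    have h1 := Finset.single_le_sum (fun e _ => hw e) (Finset.mem_univ s(a, b))
    have h2 : 0 ≤ ∑ e, w e := Finset.sum_nonneg fun e _ => hw e
    linarith⟩

theorem fracWeight_le_nuf (hw : ∀ e, 0 ≤ w e) (hx : IsFracMatching G x) :
    fracWeight w x ≤ nuf G w := by
  obtain ⟨y, hy⟩ := exists_fracCover G hw
  refine le_csSup ⟨coverValue y, ?_⟩ ⟨x, hx, rfl⟩
  rintro r ⟨z, hz, rfl⟩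
  exact fracWeight_le_coverValue hz hy

theorem isFracMatching_zero : IsFracMatching G (0 : Sym2 V → ℝ) :=
  ⟨fun _ => le_rfl, fun _ _ => rfl, fun _ => by simp⟩

theorem nuf_le_coverValue (hy : IsFracCover G w y) : nuf G w ≤ coverValue y := by
  refine csSup_le ⟨_, 0, isFracMatching_zero, rfl⟩ ?_
  rintro r ⟨z, hz, rfl⟩
  exact fracWeight_le_coverValue hz hy

theorem nonpos_of_forall_mul_lt {a K : ℝ} (h : ∀ s : ℝ, 0 ≤ s → s * a < K) : a ≤ 0 := by
  by_contra! ha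
  have hK : 0 < K := by simpa using h 0 le_rfl
  have := h (K / a) (by positivity)
  rw [div_mul_cancel₀ _ ha.ne'] at this
  exact lt_irrefl _ this

/-- Strong duality between fractional matchings and fractional vertex covers. -/
theorem exists_fracCover_le_nuf (G : SimpleGraph V) (hw : ∀ e, 0 ≤ w e) :
    ∃ y, IsFracCover G w y ∧ coverValue y ≤ nuf G w := by
  let A : Set ((V → ℝ) × ℝ) := {p | ∃ x : Sym2 V → ℝ, (∀ e, 0 ≤ x e) ∧
    (∀ e, e ∉ G.edgeSet → x e = 0) ∧ (∀ v, ∑ u, x s(v, u) < p.1 v) ∧ p.2 < fracWeight w x}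
  have hconv : Convex ℝ A := by
    rintro ⟨b, t⟩ ⟨x, hx0, hxG, hxb, hxt⟩ ⟨b', t'⟩ ⟨x', hx0', hxG', hxb', hxt'⟩ α β hα hβ hαβ
    refine ⟨fun e => α * x e + β * x' e, fun e => ?_, fun e he => ?_, fun v => ?_, ?_⟩
    · exact add_nonneg (mul_nonneg hα (hx0 e)) (mul_nonneg hβ (hx0' e))
    · simp [hxG e he, hxG' e he]
    · simp only [Finset.sum_add_distrib, ← Finset.mul_sum]
      have := (convex_Iio (0 : ℝ)) (show ∑ u, x s(v, u) - b v ∈ _ from sub_neg.2 (hxb v))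
        (show ∑ u, x' s(v, u) - b' v ∈ _ from sub_neg.2 (hxb' v)) hα hβ hαβ
      simp only [smul_eq_mul, Set.mem_Iio, Prod.fst_add, Prod.smul_fst, Pi.add_apply,
        Pi.smul_apply] at this ⊢
      linarith
    · have := (convex_Iio (0 : ℝ)) (show t - fracWeight w x ∈ _ from sub_neg.2 hxt)
        (show t' - fracWeight w x' ∈ _ from sub_neg.2 hxt') hα hβ hαβ
      have h2 : fracWeight w (fun e => α * x e + β * x' e) =
          α * fracWeight w x + β * fracWeight w x' := by
        simp only [fracWeight, Finset.mul_sum, ← Finset.sum_add_distrib]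
        exact Finset.sum_congr rfl fun _ _ => by ring
      simp only [smul_eq_mul, Set.mem_Iio, Prod.snd_add, Prod.smul_snd, h2] at this ⊢
      linarith
  have hopen : IsOpen A := by
    have : A = ⋃ x ∈ {x : Sym2 V → ℝ | (∀ e, 0 ≤ x e) ∧ (∀ e, e ∉ G.edgeSet → x e = 0)},
        {p : (V → ℝ) × ℝ | (∀ v, ∑ u, x s(v, u) < p.1 v) ∧ p.2 < fracWeight w x} := by
      ext p
      simp only [A, Set.mem_iUnion, Set.mem_ofPred_eq, exists_prop, and_assoc]
    rw [this]
    refine isOpen_biUnion fun x _ => IsOpen.inter ?_ (isOpen_lt continuous_snd continuous_const)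
    change IsOpen {p : (V → ℝ) × ℝ | ∀ v, ∑ u, x s(v, u) < p.1 v}
    rw [Set.ofPred_forall]
    exact isOpen_iInter_of_finite fun v =>
      isOpen_lt continuous_const ((continuous_apply v).comp continuous_fst)
  have hnot : ((1 : V → ℝ), nuf G w) ∉ A := by
    rintro ⟨x, hx0, hxG, hxb, hxt⟩
    exact absurd (fracWeight_le_nuf hw ⟨hx0, hxG, fun v => (hxb v).le⟩) (not_le.2 hxt)
  obtain ⟨f, hf⟩ := geometric_hahn_banach_open_point hconv hopen hnot
  set l : ℝ := f (0, 1) with hl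
  set c : V → ℝ := fun v => - f (Pi.single v 1, 0) with hc
  have hfe : ∀ b t, f (b, t) = l * t - ∑ v, c v * b v := by
    intro b t
    have h1 : ((b, t) : (V → ℝ) × ℝ) =
        ∑ v, b v • ((Pi.single v 1 : V → ℝ), (0 : ℝ)) + t • (0, 1) := by
      ext v
      · simp [Prod.fst_sum, Finset.sum_apply, Pi.single_apply]
      · simp [Prod.snd_sum]
    rw [h1, map_add, map_sum]
    simp only [map_smul, smul_eq_mul, hc, hl, neg_mul, Finset.sum_neg_distrib, sub_neg_eq_add]
    rw [add_comm, mul_comm]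
    congr 1
    exact Finset.sum_congr rfl fun _ _ => mul_comm _ _
  have key : ∀ (x : Sym2 V → ℝ) (δ : V → ℝ) (t : ℝ), (∀ e, 0 ≤ x e) →
      (∀ e, e ∉ G.edgeSet → x e = 0) → (∀ v, 0 < δ v) → t < fracWeight w x →
      l * t - ∑ v, c v * (∑ u, x s(v, u) + δ v) < l * nuf G w - ∑ v, c v := by
    intro x δ t h1 h2 h3 h4
    have := hf (fun v => ∑ u, x s(v, u) + δ v, t)
      ⟨x, h1, h2, fun v => lt_add_of_pos_right _ (h3 v), h4⟩
    simpa [hfe] using this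
  have hnu : 0 ≤ nuf G w := by
    simpa [fracWeight] using fracWeight_le_nuf hw (isFracMatching_zero (G := G))
  have hl0 : 0 < l := by
    have := key 0 1 (-1) (by simp) (by simp) (by simp) (by simp [fracWeight])
    simp only [Pi.zero_apply, Finset.sum_const_zero, Pi.one_apply, zero_add, mul_one] at this
    nlinarith
  have hc0 : ∀ v, 0 ≤ c v := by
    intro v
    rw [← neg_nonpos]
    refine nonpos_of_forall_mul_lt (K := l * (nuf G w + 1)) fun s hs => ?_
    have := key 0 (1 + Pi.single v s) (-1) (by simp) (by simp)
      (fun u => by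
        have : 0 ≤ (Pi.single v s : V → ℝ) u := by
          rw [Pi.single_apply]; split_ifs <;> simp [hs]
        simp only [Pi.add_apply, Pi.one_apply]; linarith) (by simp [fracWeight])
    simp [mul_add, Finset.sum_add_distrib, Pi.single_apply] at this
    nlinarith
  have hce : ∀ a b, G.Adj a b → l * w s(a, b) ≤ c a + c b := by
    intro a b hab
    rw [← sub_nonpos]
    refine nonpos_of_forall_mul_lt (K := l * (nuf G w + 1)) fun s hs => ?_
    let x : Sym2 V → ℝ := fun e => if e = s(a, b) then s else 0
    have hxG : ∀ e, e ∉ G.edgeSet → x e = 0 := by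
      intro e he
      refine if_neg ?_
      rintro rfl
      exact he hab
    have hwx : fracWeight w x = w s(a, b) * s := by simp [fracWeight, x]
    have h1 := key x 1 (w s(a, b) * s - 1) (fun e => by simp only [x]; split_ifs <;> simp [hs])
      hxG (by simp) (by rw [hwx]; linarith)
    have h2 := slack_identity (Sym2.lift ⟨fun u v => c u + c v, fun _ _ => add_comm _ _⟩) x c
      (fun v => hxG _ (by simp))
    simp only [Sym2.lift_mk, sub_self, zero_mul, Finset.sum_const_zero] at h2
    have h3 : fracWeight (Sym2.lift ⟨fun u v => c u + c v, fun _ _ => add_comm _ _⟩) x =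
        (c a + c b) * s := by simp [fracWeight, x]
    simp only [mul_add, Finset.sum_add_distrib, Pi.one_apply, mul_one] at h1
    nlinarith
  have hsum : ∑ v, c v ≤ l * nuf G w := by
    by_contra! hD
    have h0 : ∀ δ : ℝ, 0 < δ → ∑ v, c v - l * nuf G w < δ * (l + ∑ v, c v) := by
      intro δ hδ
      have := key 0 (fun _ => δ) (-δ) (by simp) (by simp) (fun _ => hδ) (by simp [fracWeight, hδ])
      simp [← Finset.sum_mul] at this
      nlinarith
    have hK : 0 < l + ∑ v, c v := by
      have := Finset.sum_nonneg fun v (_ : v ∈ Finset.univ) => hc0 v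
      linarith
    have := h0 ((∑ v, c v - l * nuf G w) / (l + ∑ v, c v)) (div_pos (sub_pos.2 hD) hK)
    rw [div_mul_cancel₀ _ hK.ne'] at this
    exact lt_irrefl _ this
  refine ⟨fun v => c v / l, ⟨fun v => div_nonneg (hc0 v) hl0.le, fun a b hab => ?_⟩, ?_⟩
  · rw [← add_div, le_div_iff₀ hl0, mul_comm]
    exact hce a b hab
  · rw [coverValue, ← Finset.sum_div, div_le_iff₀ hl0, mul_comm]
    exact hsum

end Duality

section Rounding

set_option linter.unusedSectionVars false

theorem mem_edgeVerts {C : Finset (Sym2 V)} {v : V} : v ∈ edgeVerts C ↔ ∃ e ∈ C, v ∈ e := Iff.rfl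

/-- A path with an even number of edges has a matching covering all its vertices but the last. -/
theorem exists_matching_of_isPath {a b : V} (p : G.Walk b a) (hp : p.IsPath)
    (he : Even p.length) :
    ∃ ρ : V → V, (∀ v, ρ (ρ v) = v) ∧ (∀ v, ρ v ≠ v → s(v, ρ v) ∈ p.edges) ∧
      (∀ v ∈ p.support, v ≠ a → ρ v ≠ v) ∧ ρ a = a := by
  match p, hp, he with
  | .nil, _, _ => exact ⟨id, by simp, by simp, by simp, rfl⟩
  | .cons h .nil, _, he => simp at he
  | .cons (v := c) h (.cons (v := d) h' q), hp, he =>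
    have hq : q.IsPath ∧ c ∉ q.support ∧ b ≠ c ∧ b ∉ q.support := by
      simp only [SimpleGraph.Walk.cons_isPath_iff, SimpleGraph.Walk.support_cons,
        List.mem_cons, not_or] at hp
      tauto
    obtain ⟨ρ, h1, h2, h3, h4⟩ := exists_matching_of_isPath q hq.1 (by
      simp only [SimpleGraph.Walk.length_cons] at he
      grind)
    have h5 : ∀ v, v ∉ q.support → ρ v = v := fun v hv => by
      by_contra hne
      exact hv (q.fst_mem_support_of_mem_edges (h2 v hne))
    have hc := h5 c hq.2.1
    have hb := h5 b hq.2.2.2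
    have ha := q.end_mem_support
    refine ⟨fun v => if v = b then c else if v = c then b else ρ v, ?_, ?_, ?_, ?_⟩
    · grind
    · intro v
      simp only [SimpleGraph.Walk.edges_cons, List.mem_cons]
      split_ifs with hvb hvc
      · subst hvb; simp
      · subst hvc; simp [Sym2.eq_swap]
      · exact fun hv => .inr (.inr (h2 v hv))
    · simp only [SimpleGraph.Walk.support_cons, List.mem_cons]
      grind
    · grind
  termination_by p.length

theorem IsOddCycleEdgeSet.exists_isPath {C : Finset (Sym2 V)} (hC : IsOddCycleEdgeSet G C) {a : V}
    (ha : a ∈ edgeVerts C) :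
    ∃ (b : V) (p : G.Walk b a), p.IsPath ∧ Even p.length ∧ 2 ≤ p.length ∧ G.Adj a b ∧
      C = insert s(a, b) p.edges.toFinset ∧ ∀ v, v ∈ edgeVerts C ↔ v ∈ p.support := by
  obtain ⟨v, c, hc, hodd, rfl⟩ := hC
  have hav : a ∈ c.support := by
    obtain ⟨e, he, hae⟩ := ha
    exact SimpleGraph.Walk.mem_support_iff_exists_mem_edges.2 (.inr ⟨e, by simpa using he, hae⟩)
  have hc' := (hc.rotate hav)
  have hed : (c.rotate a hav).edges.toFinset = c.edges.toFinset := by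
    ext e; simpa using (c.rotate_edges a hav).perm.mem_iff
  have hodd' : Odd (c.rotate a hav).length := by simpa
  rw [← hed]
  generalize c.rotate a hav = d at hc' hodd'
  cases d with
  | nil => simp at hodd'
  | cons h p =>
    rename_i b
    rw [SimpleGraph.Walk.length_cons] at hodd'
    have h3 := hc'.three_le_length
    rw [SimpleGraph.Walk.length_cons] at h3
    refine ⟨b, p, ((SimpleGraph.Walk.cons_isCycle_iff p h).1 hc').1, by grind, by omega, h,
      by simp, fun v => ?_⟩
    rw [SimpleGraph.Walk.mem_support_iff_exists_mem_edges, mem_edgeVerts]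
    simp only [SimpleGraph.Walk.edges_cons, List.toFinset_cons, Finset.mem_insert,
      List.mem_toFinset]
    constructor
    · rintro ⟨e, rfl | he, hv⟩
      · rcases Sym2.mem_iff.1 hv with rfl | rfl
        · exact .inl rfl
        · exact SimpleGraph.Walk.mem_support_iff_exists_mem_edges.1 p.start_mem_support
      · exact .inr ⟨e, he, hv⟩
    · rintro (rfl | ⟨e, he, hv⟩)
      · exact ⟨_, .inl rfl, by simp⟩
      · exact ⟨e, .inr he, hv⟩

/-- Alternate rounding: an odd cycle minus a vertex has a perfect matching. -/
theorem IsOddCycleEdgeSet.exists_matching {C : Finset (Sym2 V)} (hC : IsOddCycleEdgeSet G C)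
    {a : V} (ha : a ∈ edgeVerts C) :
    ∃ ρ : V → V, (∀ v, ρ (ρ v) = v) ∧ (∀ v, ρ v ≠ v → s(v, ρ v) ∈ C) ∧
      (∀ v ∈ edgeVerts C, v ≠ a → ρ v ≠ v) ∧ ρ a = a := by
  obtain ⟨b, p, hp, he, -, -, hCp, hv⟩ := hC.exists_isPath ha
  obtain ⟨ρ, h1, h2, h3, h4⟩ := exists_matching_of_isPath p hp he
  exact ⟨ρ, h1, fun v h => by simp [hCp, h2 v h], fun v h => h3 v ((hv v).1 h), h4⟩

theorem IsOddCycleEdgeSet.nonempty {C : Finset (Sym2 V)} (hC : IsOddCycleEdgeSet G C) :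
    (edgeVerts C).Nonempty := by
  obtain ⟨v, c, hc, -, rfl⟩ := hC
  cases c with
  | nil => simp at hc
  | cons h p =>
    rename_i b
    exact ⟨v, s(v, b), by simp, by simp⟩

theorem IsOddCycleEdgeSet.three_le {C : Finset (Sym2 V)} (hC : IsOddCycleEdgeSet G C)
    (T : Finset V) (hT : ∀ v ∈ edgeVerts C, v ∈ T) : 3 ≤ T.card := by
  obtain ⟨a, ha⟩ := hC.nonempty
  obtain ⟨b, p, hp, -, hl, -, -, hv⟩ := hC.exists_isPath ha
  have h1 : p.support.toFinset.card = p.length + 1 := by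
    rw [List.toFinset_card_of_nodup hp.support_nodup, SimpleGraph.Walk.length_support]
  have h2 : p.support.toFinset ⊆ T := fun v h => hT v ((hv v).2 (by simpa using h))
  have := Finset.card_le_card h2
  omega

/-- Every vertex of an odd cycle lies on exactly two of its edges. -/
theorem IsOddCycleEdgeSet.sum_eq {C : Finset (Sym2 V)} (hC : IsOddCycleEdgeSet G C) {a : V}
    (ha : a ∈ edgeVerts C) : ∑ u, (if s(a, u) ∈ C then (1 / 2 : ℝ) else 0) = 1 := by
  obtain ⟨v, c, hc, -, rfl⟩ := hC
  have hav : a ∈ c.support := by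
    obtain ⟨e, he, hae⟩ := ha
    exact SimpleGraph.Walk.mem_support_iff_exists_mem_edges.2 (.inr ⟨e, by simpa using he, hae⟩)
  have h := hc.ncard_neighborSet_toSubgraph_eq_two hav
  have h2 : c.toSubgraph.neighborSet a =
      ↑(Finset.univ.filter fun u => s(a, u) ∈ c.edges.toFinset) := by
    ext u
    simp [SimpleGraph.Subgraph.mem_neighborSet, SimpleGraph.Walk.adj_toSubgraph_iff_mem_edges]
  rw [h2, Set.ncard_coe_finset] at h
  rw [← Finset.sum_filter, Finset.sum_const, h]
  norm_num

end Rounding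

section TightState

set_option linter.unusedSectionVars false

/-- `u` and `v` are joined by an edge that is tight for `y`. -/
def TightAdj (G : SimpleGraph V) (w : Sym2 V → ℝ) (y : V → ℝ) (u v : V) : Prop :=
  G.Adj u v ∧ w s(u, v) = y u + y v

/-- A matching (the involution `μ`) and a family `F` of odd cycles, all disjoint and tight for
the cover `y`, such that uncovered vertices outside `R` have `y`-value zero. -/
structure TightState (G : SimpleGraph V) (w : Sym2 V → ℝ) (y : V → ℝ) (μ : V → V)
    (F : Finset (Finset (Sym2 V))) (R : Finset V) : Prop where
  cover : IsFracCover G w y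
  invol : ∀ v, μ (μ v) = v
  tight : ∀ v, μ v ≠ v → TightAdj G w y v (μ v)
  isCycle : ∀ C ∈ F, IsOddCycleEdgeSet G C
  cycle_tight : ∀ C ∈ F, ∀ u v, s(u, v) ∈ C → w s(u, v) = y u + y v
  disjoint : ∀ C ∈ F, ∀ D ∈ F, C ≠ D → Disjoint (edgeVerts C) (edgeVerts D)
  fixed : ∀ C ∈ F, ∀ v ∈ edgeVerts C, μ v = v
  exposed : ∀ v, μ v = v → (∀ C ∈ F, v ∉ edgeVerts C) → v ∉ R → y v = 0

variable {w : Sym2 V → ℝ} {y : V → ℝ} {μ : V → V} {F : Finset (Finset (Sym2 V))} {R : Finset V}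

theorem TightAdj.symm {u v : V} (h : TightAdj G w y u v) : TightAdj G w y v u :=
  ⟨h.1.symm, by rw [Sym2.eq_swap, h.2, add_comm]⟩

theorem IsOddCycleEdgeSet.subset_edgeSet {C : Finset (Sym2 V)} (hC : IsOddCycleEdgeSet G C)
    {e : Sym2 V} (he : e ∈ C) : e ∈ G.edgeSet := by
  obtain ⟨v, c, -, -, rfl⟩ := hC
  exact c.edges_subset_edgeSet (by simpa using he)

namespace TightState

theorem mono (h : TightState G w y μ F R) {R' : Finset V} (hR : ∀ v ∈ R, v ∈ R' ∨ y v = 0) :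
    TightState G w y μ F R' :=
  { h with
    exposed := fun v h1 h2 h3 => by
      by_cases hv : v ∈ R
      · exact (hR v hv).resolve_left h3
      · exact h.exposed v h1 h2 hv }

/-- Unmatching the pair `a`, `μ a`. -/
theorem expose (h : TightState G w y μ F R) (a : V) :
    TightState G w y (fun v => if v = a ∨ v = μ a then v else μ v) F
      (insert a (insert (μ a) R)) :=
  { h with
    invol := fun v => by have := h.invol; grind
    tight := fun v hv => by
      by_cases hva : v = a ∨ v = μ a
      · simp [hva] at hv
      · simp only [hva, if_false] at hv ⊢
        exact h.tight v hv
    fixed := fun C hC v hv => by have := h.fixed C hC v hv; grind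
    exposed := fun v h1 h2 h3 => by
      simp only [Finset.mem_insert, not_or] at h3
      exact h.exposed v (by grind) h2 h3.2.2 }

/-- Matching two uncovered vertices joined by a tight edge. -/
theorem join (h : TightState G w y μ F R) {o a : V} (hoa : TightAdj G w y o a)
    (ho : μ o = o) (ha : μ a = a) (hoF : ∀ C ∈ F, o ∉ edgeVerts C)
    (haF : ∀ C ∈ F, a ∉ edgeVerts C) :
    TightState G w y (fun v => if v = o then a else if v = a then o else μ v) F
      ((R.erase o).erase a) :=
  { h with
    invol := fun v => by have := h.invol; grind
    tight := fun v hv => by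
      have := hoa.symm
      have := h.tight v
      grind
    fixed := fun C hC v hv => by
      have h1 : v ≠ o := fun e => hoF C hC (e ▸ hv)
      have h2 : v ≠ a := fun e => haF C hC (e ▸ hv)
      simp [h1, h2, h.fixed C hC v hv]
    exposed := fun v h1 h2 h3 => by
      have := hoa.1.ne
      exact h.exposed v (by grind) h2 (by grind) }

/-- Alternate rounding of a cycle at one of its vertices. -/
theorem round (h : TightState G w y μ F R) {C : Finset (Sym2 V)} (hC : C ∈ F) {a : V}
    (ha : a ∈ edgeVerts C) :
    ∃ μ', TightState G w y μ' (F.erase C) (insert a R) ∧ μ' a = a ∧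
      ∀ v ∉ edgeVerts C, μ' v = μ v := by
  classical
  obtain ⟨ρ, h1, h2, h3, h4⟩ := (h.isCycle C hC).exists_matching ha
  have hρ : ∀ v ∈ edgeVerts C, ρ v ∈ edgeVerts C := fun v hv => by
    by_cases hvρ : ρ v = v
    · rwa [hvρ]
    · exact ⟨_, h2 v hvρ, by simp⟩
  have hμ : ∀ v ∉ edgeVerts C, μ v ∉ edgeVerts C := fun v hv hv' => by
    have := h.fixed C hC _ hv'
    rw [h.invol] at this
    exact hv (this ▸ hv')
  refine ⟨fun v => if v ∈ edgeVerts C then ρ v else μ v, ⟨h.cover, fun v => ?_, fun v hv => ?_,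
    fun D hD => h.isCycle D (Finset.mem_of_mem_erase hD),
    fun D hD => h.cycle_tight D (Finset.mem_of_mem_erase hD),
    fun D hD E hE => h.disjoint D (Finset.mem_of_mem_erase hD) E (Finset.mem_of_mem_erase hE),
    fun D hD v hv => ?_, fun v hv hF hR => ?_⟩, by simp [ha, h4], fun v hv => by simp [hv]⟩
  · have := h.invol
    grind
  · by_cases hvC : v ∈ edgeVerts C
    · simp only [hvC, if_true] at hv ⊢
      exact ⟨(h.isCycle C hC).subset_edgeSet (h2 v hv), h.cycle_tight C hC _ _ (h2 v hv)⟩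
    · simp only [hvC, if_false] at hv ⊢
      exact h.tight v hv
  · have hD' := Finset.mem_erase.1 hD
    have : v ∉ edgeVerts C := fun hvC =>
      Set.disjoint_left.1 (h.disjoint D hD'.2 C hC hD'.1) hv hvC
    simp [this, h.fixed D hD'.2 v hv]
  · simp only [Finset.mem_insert, not_or] at hR
    by_cases hvC : v ∈ edgeVerts C
    · simp only [hvC, if_true] at hv
      exact absurd hv (h3 v hvC hR.1)
    · simp only [hvC, if_false] at hv
      refine h.exposed v hv (fun D hD => ?_) hR.2
      by_cases hDC : D = C
      · rwa [hDC]
      · exact hF D (Finset.mem_erase.2 ⟨hDC, hD⟩)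

theorem round_all (a : Finset (Sym2 V) → V) (h : TightState G w y μ F R)
    (ha : ∀ C ∈ F, a C ∈ edgeVerts C) :
    ∃ μ', TightState G w y μ' ∅ (R ∪ F.image a) ∧ (∀ C ∈ F, μ' (a C) = a C) ∧
      ∀ v, (∀ C ∈ F, v ∉ edgeVerts C) → μ' v = μ v := by
  induction F using Finset.induction generalizing μ R with
  | empty => exact ⟨μ, by simpa using h, by simp, by simp⟩
  | insert C F hCF ih =>
    obtain ⟨μ₁, h1, h2, h3⟩ := h.round (Finset.mem_insert_self C F)
      (ha C (Finset.mem_insert_self C F))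
    rw [Finset.erase_insert hCF] at h1
    obtain ⟨μ₂, h4, h5, h6⟩ := ih h1 fun D hD => ha D (Finset.mem_insert_of_mem hD)
    refine ⟨μ₂, ?_, ?_, ?_⟩
    · rwa [Finset.image_insert, Finset.union_insert, ← Finset.insert_union]
    · intro D hD
      rcases Finset.mem_insert.1 hD with rfl | hD
      · rw [h6 _ fun E hE hDE => ?_, h2]
        have hne : D ≠ E := fun e => hCF (e ▸ hE)
        exact Set.disjoint_left.1 (h.disjoint D (Finset.mem_insert_self _ _) E
          (Finset.mem_insert_of_mem hE) hne) (ha D (Finset.mem_insert_self _ _)) hDE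
      · exact h5 D hD
    · intro v hv
      rw [h6 v fun D hD => hv D (Finset.mem_insert_of_mem hD),
        h3 v (hv C (Finset.mem_insert_self _ _))]

end TightState

/-- An alternating path from `r` to `o` (listed backwards: `o` followed by `l`), whose edges are
alternately tight and matched by `μ`. -/
inductive AltPath (G : SimpleGraph V) (w : Sym2 V → ℝ) (y : V → ℝ) (μ : V → V) (r : V) :
    V → List V → Prop
  | base : AltPath G w y μ r r []
  | step {o a : V} {l : List V} : AltPath G w y μ r o l → TightAdj G w y o a → μ a ≠ a →
      a ∉ o :: l → μ a ∉ o :: l → AltPath G w y μ r (μ a) (a :: o :: l)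

variable {r : V}

namespace AltPath

theorem root_mem {o : V} {l : List V} (h : AltPath G w y μ r o l) : r ∈ o :: l := by
  induction h <;> simp_all

theorem eq_root_or_ne (hμ : ∀ v, μ (μ v) = v) {o : V} {l : List V} (h : AltPath G w y μ r o l)
    {v : V} (hv : v ∈ o :: l) : v = r ∨ μ v ≠ v := by
  induction h with
  | base => simp_all
  | step _ _ h1 _ _ ih =>
    rcases List.mem_cons.1 hv with rfl | hv
    · rw [hμ]; exact .inr h1.symm
    rcases List.mem_cons.1 hv with rfl | hv
    · exact .inr h1
    · exact ih hv

theorem map_mem (hμ : ∀ v, μ (μ v) = v) (hr : μ r = r) {o : V} {l : List V}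
    (h : AltPath G w y μ r o l) {v : V} (hv : v ∈ o :: l) : μ v ∈ o :: l := by
  induction h with
  | base => simp_all
  | step _ _ h1 _ _ ih =>
    rcases List.mem_cons.1 hv with rfl | hv
    · rw [hμ]; simp
    rcases List.mem_cons.1 hv with rfl | hv
    · simp
    · exact List.mem_cons_of_mem _ (List.mem_cons_of_mem _ (ih hv))

/-- A vertex of an alternating path is either an inner one, and then its partner is the end of
an alternating path, or it cuts the path into an alternating path and an even tight path. -/
theorem split (hμ : ∀ v, μ (μ v) = v) (ht : ∀ v, μ v ≠ v → TightAdj G w y v (μ v))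
    {o : V} {l : List V} (h : AltPath G w y μ r o l)
    {v : V} (hv : v ∈ o :: l) :
    (μ v ≠ v ∧ ∃ l', AltPath G w y μ r (μ v) l') ∨
    ∃ (l' : List V) (q : G.Walk o v), AltPath G w y μ r v l' ∧ q.IsPath ∧ Even q.length ∧
      (∀ x ∈ q.support, x ∈ o :: l) ∧ (∀ x ∈ v :: l', x ∈ o :: l) ∧
      (∀ x ∈ q.support, x ≠ v → x ∉ v :: l' ∧ μ x ∈ q.support) ∧
      ∀ a b, s(a, b) ∈ q.edges → w s(a, b) = y a + y b := by
  induction h with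
  | base =>
    obtain rfl : v = r := by simpa using hv
    exact .inr ⟨[], .nil, .base, by simp, by simp, by simp, by simp, by simp, by simp⟩
  | step h hoa h1 h2 h3 ih =>
    rename_i o a l
    rcases List.mem_cons.1 hv with rfl | hv
    · exact .inr ⟨_, .nil, .step h hoa h1 h2 h3, by simp, by simp, by simp, by simp, by simp,
        by simp⟩
    rcases List.mem_cons.1 hv with rfl | hv
    · exact .inl ⟨h1, _, .step h hoa h1 h2 h3⟩
    rcases ih hv with h4 | ⟨l', q, h4, h5, h6, h7, h8, h9, h10⟩
    · exact .inl h4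
    · have h11 := ht a h1
      have hav : a ≠ v := fun e => h2 (e ▸ hv)
      have hbv : μ a ≠ v := fun e => h3 (e ▸ hv)
      refine .inr ⟨l', .cons h11.symm.1 (.cons hoa.symm.1 q), h4, ?_, ?_, ?_, ?_, ?_, ?_⟩
      · simp only [SimpleGraph.Walk.cons_isPath_iff, SimpleGraph.Walk.support_cons,
          List.mem_cons, not_or]
        exact ⟨⟨h5, fun h => h2 (h7 a h)⟩, h1, fun h => h3 (h7 _ h)⟩
      · simp only [SimpleGraph.Walk.length_cons]
        grind
      · simp only [SimpleGraph.Walk.support_cons, List.mem_cons]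
        intro x hx
        have := fun h => List.mem_cons.1 (h7 x h)
        tauto
      · exact fun x hx => List.mem_cons_of_mem _ (List.mem_cons_of_mem _ (h8 x hx))
      · intro x hx hxv
        simp only [SimpleGraph.Walk.support_cons, List.mem_cons (a := x)] at hx
        rcases hx with rfl | rfl | hx
        · exact ⟨fun h => h3 (h8 _ h), by simp [hμ]⟩
        · exact ⟨fun h => h2 (h8 _ h), by simp⟩
        · exact ⟨(h9 x hx hxv).1, by simp [(h9 x hx hxv).2]⟩
      · intro b c hbc
        simp only [SimpleGraph.Walk.edges_cons, List.mem_cons] at hbc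
        rcases hbc with hbc | hbc | hbc
        · rw [hbc, h11.symm.2]
          rcases Sym2.eq_iff.1 hbc with ⟨rfl, rfl⟩ | ⟨rfl, rfl⟩
          · rfl
          · exact add_comm _ _
        · rw [hbc, hoa.symm.2]
          rcases Sym2.eq_iff.1 hbc with ⟨rfl, rfl⟩ | ⟨rfl, rfl⟩
          · rfl
          · exact add_comm _ _
        · exact h10 b c hbc

end AltPath

/-- Switching along an alternating path moves the uncovered vertex from `r` to `o`. -/
theorem TightState.switch (h : TightState G w y μ F R) (hr : r ∈ R) (hμr : μ r = r)
    (hrF : ∀ C ∈ F, r ∉ edgeVerts C) {o : V} {l : List V} (hP : AltPath G w y μ r o l) :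
    ∃ μ', TightState G w y μ' F (insert o (R.erase r)) ∧ μ' o = o ∧ ∀ v ∉ o :: l, μ' v = μ v := by
  induction hP with
  | base => exact ⟨μ, by rwa [Finset.insert_erase hr], hμr, fun _ _ => rfl⟩
  | step hP hoa h1 h2 h3 ih =>
    rename_i o a l
    obtain ⟨μ₁, h4, h5, h6⟩ := ih
    have haF : ∀ C ∈ F, a ∉ edgeVerts C := fun C hC ha => h1 (h.fixed C hC a ha)
    have hoF : ∀ C ∈ F, o ∉ edgeVerts C := fun C hC ho => by
      rcases hP.eq_root_or_ne h.invol (List.mem_cons_self ..) with rfl | hne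
      · exact hrF C hC ho
      · exact hne (h.fixed C hC o ho)
    have hao : a ≠ o := fun e => h2 (by simp [e])
    have hbo : μ a ≠ o := fun e => h3 (by simp [e])
    have h7 := (h4.expose a).join hoa (by simp [h5]) (by simp) hoF haF
    rw [h6 a h2] at h7
    refine ⟨_, h7.mono fun v hv => .inl (by grind), ?_, fun v hv => ?_⟩
    · simp [hbo, h1]
    · simp only [List.mem_cons, not_or] at hv
      simp [hv, h6 v (by simp [hv])]

/-- The number of uncovered vertices can be decreased, without increasing the number of
uncovered vertices plus odd cycles. -/
def Improvable (G : SimpleGraph V) (w : Sym2 V → ℝ) (y : V → ℝ)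
    (F : Finset (Finset (Sym2 V))) (R : Finset V) : Prop :=
  ∃ μ' F' R', TightState G w y μ' F' R' ∧ R'.card < R.card ∧
    F'.card + R'.card ≤ F.card + R.card

theorem Improvable.of_erase {F' : Finset (Finset (Sym2 V))} (hr : r ∈ R)
    (h : TightState G w y μ F' (R.erase r)) (hF : F'.card ≤ F.card + 1) :
    Improvable G w y F R := by
  have := Finset.card_erase_add_one hr
  exact ⟨μ, F', R.erase r, h, by omega, by omega⟩

/-- A tight edge closing an even tight path into a flower. -/
theorem TightState.improvable_of_flower (h : TightState G w y μ F R) (hr : r ∈ R) (hμr : μ r = r)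
    (hrF : ∀ C ∈ F, r ∉ edgeVerts C) {o v : V} {l l' : List V} (hP : AltPath G w y μ r o l)
    (hov : TightAdj G w y o v) (q : G.Walk o v) (hP' : AltPath G w y μ r v l') (hq : q.IsPath)
    (hev : Even q.length) (hql : ∀ x ∈ q.support, x ∈ o :: l)
    (hqv : ∀ x ∈ q.support, x ≠ v → x ∉ v :: l' ∧ μ x ∈ q.support)
    (hqt : ∀ a b, s(a, b) ∈ q.edges → w s(a, b) = y a + y b) : Improvable G w y F R := by
  obtain ⟨μ₁, h1, h2, h3⟩ := h.switch hr hμr hrF hP'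
  have hlen : 2 ≤ q.length := by
    have : q.length ≠ 0 := fun h0 => hov.1.ne (SimpleGraph.Walk.eq_of_length_eq_zero h0)
    grind
  have hvo : s(v, o) ∉ q.edges := by
    cases q with
    | nil => simp at hlen
    | cons h' q' =>
      intro hmem
      rw [SimpleGraph.Walk.cons_isPath_iff] at hq
      rw [SimpleGraph.Walk.edges_cons, List.mem_cons] at hmem
      rcases hmem with hmem | hmem
      · rename_i z
        have hvz : v = z := by
          have := hov.1.ne
          grind [Sym2.eq_iff]
        subst hvz
        have := SimpleGraph.Walk.isPath_iff_nil.1 hq.1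
        rw [SimpleGraph.Walk.length_cons, SimpleGraph.Walk.length_eq_zero_iff.2 this] at hlen
        omega
      · exact hq.2 (q'.snd_mem_support_of_mem_edges hmem)
  let c := SimpleGraph.Walk.cons hov.1.symm q
  have hc : c.IsCycle := (SimpleGraph.Walk.cons_isCycle_iff q _).2 ⟨hq, hvo⟩
  have hcv : ∀ x, x ∈ edgeVerts c.edges.toFinset ↔ x ∈ q.support := by
    intro x
    rw [SimpleGraph.Walk.mem_support_iff_exists_mem_edges, mem_edgeVerts]
    simp only [c, SimpleGraph.Walk.edges_cons, List.toFinset_cons, Finset.mem_insert,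
      List.mem_toFinset]
    constructor
    · rintro ⟨e, rfl | he, hx⟩
      · rcases Sym2.mem_iff.1 hx with rfl | rfl
        · exact .inl rfl
        · exact SimpleGraph.Walk.mem_support_iff_exists_mem_edges.1 q.start_mem_support
      · exact .inr ⟨e, he, hx⟩
    · rintro (rfl | ⟨e, he, hx⟩)
      · exact ⟨_, .inl rfl, by simp⟩
      · exact ⟨e, .inr he, hx⟩
  have hqF : ∀ C ∈ F, ∀ x ∈ edgeVerts C, x ∉ q.support := fun C hC x hx hxq => by
    rcases hP.eq_root_or_ne h.invol (hql x hxq) with rfl | hne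
    · exact hrF C hC hx
    · exact hne (h.fixed C hC x hx)
  have hμ₁ : ∀ x ∉ q.support, μ₁ x ∉ q.support := fun x hx hx' => by
    have hinv := h1.invol x
    by_cases hxv : μ₁ x = v
    · rw [hxv, h2] at hinv
      exact hx (hinv ▸ q.end_mem_support)
    · rw [h3 _ (hqv _ hx' hxv).1] at hinv
      exact hx (hinv ▸ (hqv _ hx' hxv).2)
  refine Improvable.of_erase (μ := fun x => if x ∈ q.support then x else μ₁ x)
    (F' := insert c.edges.toFinset F) hr ⟨h.cover, fun x => ?_, fun x hx => ?_, fun C hC => ?_,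
    fun C hC a b hab => ?_, fun C hC D hD hCD => ?_, fun C hC x hx => ?_, fun x hx hF hR => ?_⟩
    (Finset.card_insert_le _ _)
  · have := h1.invol
    grind
  · by_cases hxq : x ∈ q.support
    · simp [hxq] at hx
    · simp only [hxq, if_false] at hx ⊢
      exact h1.tight x hx
  · rcases Finset.mem_insert.1 hC with rfl | hC
    · exact ⟨v, c, hc, by simp only [c, SimpleGraph.Walk.length_cons]; grind, rfl⟩
    · exact h.isCycle C hC
  · rcases Finset.mem_insert.1 hC with rfl | hC
    · simp only [c, SimpleGraph.Walk.edges_cons, List.toFinset_cons, Finset.mem_insert,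
        List.mem_toFinset] at hab
      rcases hab with hab | hab
      · rw [hab, hov.symm.2]
        rcases Sym2.eq_iff.1 hab with ⟨rfl, rfl⟩ | ⟨rfl, rfl⟩
        · rfl
        · exact add_comm _ _
      · exact hqt a b hab
    · exact h.cycle_tight C hC a b hab
  · rcases Finset.mem_insert.1 hC with rfl | hC <;> rcases Finset.mem_insert.1 hD with rfl | hD
    · exact absurd rfl hCD
    · exact Set.disjoint_left.2 fun x hx hx' => hqF D hD x hx' ((hcv x).1 hx)
    · exact Set.disjoint_left.2 fun x hx hx' => hqF C hC x hx ((hcv x).1 hx')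
    · exact h.disjoint C hC D hD hCD
  · rcases Finset.mem_insert.1 hC with rfl | hC
    · simp [(hcv x).1 hx]
    · simp [hqF C hC x hx, h1.fixed C hC x hx]
  · have hxq : x ∉ q.support := fun hxq => hF _ (Finset.mem_insert_self _ _) ((hcv x).2 hxq)
    have hxv : x ≠ v := fun e => hxq (e ▸ q.end_mem_support)
    simp only [hxq, if_false] at hx
    exact h1.exposed x hx (fun C hC => hF C (Finset.mem_insert_of_mem hC)) (by grind)

/-- The end of an alternating path from `r`, along a tight edge followed by a matched one. -/
inductive Outer (G : SimpleGraph V) (w : Sym2 V → ℝ) (y : V → ℝ) (μ : V → V) (r : V) : V → Prop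
  | base : Outer G w y μ r r
  | step {o a : V} : Outer G w y μ r o → TightAdj G w y o a → μ a ≠ a → Outer G w y μ r (μ a)

theorem Outer.exists_altPath (h : TightState G w y μ F R) (hr : r ∈ R) (hμr : μ r = r)
    (hrF : ∀ C ∈ F, r ∉ edgeVerts C) (hI : ¬ Improvable G w y F R) {o : V}
    (ho : Outer G w y μ r o) : ∃ l, AltPath G w y μ r o l := by
  induction ho with
  | base => exact ⟨[], .base⟩
  | step ho hoa h1 ih =>
    rename_i o a
    obtain ⟨l, hP⟩ := ih
    by_cases hal : a ∈ o :: l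
    · rcases hP.split h.invol h.tight hal with ⟨-, h2⟩ | ⟨l', q, h3, h4, h5, h6, -, h8, h9⟩
      · exact h2
      · exact absurd (h.improvable_of_flower hr hμr hrF hP hoa q h3 h4 h5 h6 h8 h9) hI
    · refine ⟨_, .step hP hoa h1 hal fun hb => hal ?_⟩
      rw [← h.invol a]
      exact hP.map_mem h.invol hμr hb

theorem Outer.not_tightAdj (h : TightState G w y μ F R) (hr : r ∈ R) (hμr : μ r = r)
    (hrF : ∀ C ∈ F, r ∉ edgeVerts C) (hI : ¬ Improvable G w y F R) {o o' : V}
    (ho : Outer G w y μ r o) (ho' : Outer G w y μ r o') : ¬ TightAdj G w y o o' := by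
  induction ho' generalizing o with
  | base =>
    intro hor
    obtain ⟨l, hP⟩ := ho.exists_altPath h hr hμr hrF hI
    rcases hP.split h.invol h.tight hP.root_mem with ⟨h2, -⟩ | ⟨l', q, h3, h4, h5, h6, -, h8, h9⟩
    · exact h2 hμr
    · exact absurd (h.improvable_of_flower hr hμr hrF hP hor q h3 h4 h5 h6 h8 h9) hI
  | step ho' hoa h1 ih =>
    rename_i o' a
    intro hoo'
    have := ho.step hoo' (by rw [h.invol]; exact h1.symm)
    rw [h.invol] at this
    exact ih this hoa.symm

theorem Outer.pos (h : TightState G w y μ F R) (hr : r ∈ R) (hμr : μ r = r)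
    (hrF : ∀ C ∈ F, r ∉ edgeVerts C) (hI : ¬ Improvable G w y F R) {o : V}
    (ho : Outer G w y μ r o) : 0 < y o := by
  refine lt_of_le_of_ne (h.cover.1 o) fun h0 => hI ?_
  obtain ⟨l, hP⟩ := ho.exists_altPath h hr hμr hrF hI
  obtain ⟨μ₁, h1, -, -⟩ := h.switch hr hμr hrF hP
  refine .of_erase hr (h1.mono fun v hv => ?_) (Nat.le_succ _)
  rcases Finset.mem_insert.1 hv with rfl | hv
  · exact .inr h0.symm
  · exact .inl hv

theorem Outer.matched (h : TightState G w y μ F R) (hr : r ∈ R) (hμr : μ r = r)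
    (hrF : ∀ C ∈ F, r ∉ edgeVerts C) (hI : ¬ Improvable G w y F R) {o a : V}
    (ho : Outer G w y μ r o) (hoa : TightAdj G w y o a) : μ a ≠ a := by
  intro ha
  obtain ⟨l, hP⟩ := ho.exists_altPath h hr hμr hrF hI
  have har : a ≠ r := fun e => ho.not_tightAdj h hr hμr hrF hI .base (e ▸ hoa)
  have hal : a ∉ o :: l := fun hal =>
    (hP.eq_root_or_ne h.invol hal).elim har fun hne => hne ha
  obtain ⟨μ₁, h1, h2, h3⟩ := h.switch hr hμr hrF hP
  have hoF : ∀ C ∈ F, o ∉ edgeVerts C := fun C hC hoC => by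
    rcases hP.eq_root_or_ne h.invol (List.mem_cons_self ..) with rfl | hne
    · exact hrF C hC hoC
    · exact hne (h.fixed C hC o hoC)
  have h4 : μ₁ a = a := by rw [h3 a hal, ha]
  by_cases haF : ∃ C ∈ F, a ∈ edgeVerts C
  · obtain ⟨C, hC, haC⟩ := haF
    obtain ⟨μ₂, h5, h6, h7⟩ := h1.round hC haC
    have h8 := h5.join hoa (by rw [h7 o (hoF C hC), h2]) h6
      (fun D hD => hoF D (Finset.mem_of_mem_erase hD)) fun D hD haD =>
        Set.disjoint_left.1 (h.disjoint D (Finset.mem_of_mem_erase hD) C hC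
          (Finset.ne_of_mem_erase hD)) haD haC
    exact hI (.of_erase hr (h8.mono fun v hv => .inl (by grind))
      ((Finset.card_erase_le).trans (Nat.le_succ _)))
  · push Not at haF
    have h8 := h1.join hoa h2 h4 hoF haF
    exact hI (.of_erase hr (h8.mono fun v hv => .inl (by grind)) (Nat.le_succ _))

end TightState

section Extremal

set_option linter.unusedSectionVars false

variable {w : Sym2 V → ℝ} {y : V → ℝ} {μ : V → V} {F : Finset (Finset (Sym2 V))} {R : Finset V}

theorem exists_pos_forall_le {ι : Type*} [Finite ι] (f : ι → ℝ) :
    ∃ ε > 0, ∀ i, 0 < f i → ε ≤ f i := by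
  have h : ∀ᶠ ε in nhdsWithin (0 : ℝ) (Set.Ioi 0), ∀ i, 0 < f i → ε ≤ f i := by
    rw [Filter.eventually_all]
    intro i
    by_cases hi : 0 < f i
    · filter_upwards [nhdsWithin_le_nhds (Iic_mem_nhds hi)] with ε hε _ using hε
    · simp [hi]
  obtain ⟨ε, h1, h2⟩ := (h.and self_mem_nhdsWithin).exists
  exact ⟨ε, h2, h1⟩

/-- The dual change: if no improvement can be reached from the uncovered vertex `r`, then `y`
is not a cheapest cover. -/
theorem TightState.exists_coverValue_lt {r : V} (h : TightState G w y μ F R) (hr : r ∈ R)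
    (hμr : μ r = r) (hrF : ∀ C ∈ F, r ∉ edgeVerts C) (hI : ¬ Improvable G w y F R) :
    ∃ y', TightState G w y' μ F R ∧ coverValue y' < coverValue y := by
  classical
  have hout : ∀ o, Outer G w y μ r o → o ≠ r → ¬ Outer G w y μ r (μ o) := by
    intro o ho hor
    cases ho with
    | base => exact absurd rfl hor
    | step ho hoa h1 =>
      rw [h.invol]
      exact fun ha => ho.not_tightAdj h hr hμr hrF hI ha hoa
  have hμ : ∀ v, v ≠ r → μ v ≠ r := fun v hv e => hv (by rw [← h.invol v, e, hμr])
  let f : V → ℝ := fun v => if Outer G w y μ r v then -1 else if Outer G w y μ r (μ v) then 1 else 0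
  have hf : ∀ v, f v = if Outer G w y μ r v then -1 else if Outer G w y μ r (μ v) then 1 else 0 :=
    fun v => rfl
  have hfr : f r = -1 := by simp [hf, Outer.base]
  have hneg : ∀ v, v ≠ r → f v + f (μ v) = 0 := by
    intro v hv
    have h1 := hout v
    have h2 := hout (μ v)
    have h3 := hμ v hv
    simp only [hf, h.invol] at *
    by_cases h4 : Outer G w y μ r v <;> by_cases h5 : Outer G w y μ r (μ v) <;> simp_all
  have hzero : ∀ v, v ≠ r → μ v = v → f v = 0 := fun v hv e => by
    have := hneg v hv
    rw [e] at this
    linarith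
  have hge : ∀ v, -1 ≤ f v := fun v => by rw [hf]; split_ifs <;> norm_num
  have hout_nbr : ∀ u v, Outer G w y μ r u → TightAdj G w y u v → f u + f v = 0 := by
    intro u v hu huv
    have h1 : ¬ Outer G w y μ r v := fun hv => hu.not_tightAdj h hr hμr hrF hI hv huv
    have h2 := hu.step huv (hu.matched h hr hμr hrF hI huv)
    simp [hf, hu, h1, h2]
  have hnonneg : ∀ u, ¬ Outer G w y μ r u → 0 ≤ f u := fun u hu => by
    rw [hf, if_neg hu]; split_ifs <;> norm_num
  have htight : ∀ u v, TightAdj G w y u v → 0 ≤ f u + f v := by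
    intro u v huv
    by_cases hu : Outer G w y μ r u
    · exact (hout_nbr u v hu huv).ge
    by_cases hv : Outer G w y μ r v
    · rw [add_comm]
      exact (hout_nbr v u hv huv.symm).ge
    · exact add_nonneg (hnonneg u hu) (hnonneg v hv)
  have hsum : ∑ v, f v = -1 := by
    rw [← Finset.add_sum_erase _ _ (Finset.mem_univ r), hfr, add_eq_left]
    refine Finset.sum_involution (fun v _ => μ v) (fun v hv => hneg v (Finset.ne_of_mem_erase hv))
      (fun v hv hfv e => hfv (hzero v (Finset.ne_of_mem_erase hv) e))
      (fun v hv => by simpa using hμ v (Finset.ne_of_mem_erase hv)) fun v _ => h.invol v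
  obtain ⟨ε, hε, hεy⟩ := exists_pos_forall_le y
  obtain ⟨δ, hδ, hδw⟩ := exists_pos_forall_le fun p : V × V => y p.1 + y p.2 - w s(p.1, p.2)
  let c := min ε (δ / 2)
  have hc : 0 < c := lt_min hε (by linarith)
  have hcε : c ≤ ε := min_le_left _ _
  have hcδ : c ≤ δ / 2 := min_le_right _ _
  refine ⟨fun v => y v + c * f v, ⟨⟨fun v => ?_, fun u v huv => ?_⟩, h.invol, fun v hv => ?_,
    h.isCycle, fun C hC u v huv => ?_, h.disjoint, h.fixed, fun v h1 h2 h3 => ?_⟩, ?_⟩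
  · by_cases hv : Outer G w y μ r v
    · have := hεy v (hv.pos h hr hμr hrF hI)
      have : f v = -1 := by simp [hf, hv]
      simp only [this]
      linarith
    · exact add_nonneg (h.cover.1 v) (mul_nonneg hc.le (hnonneg v hv))
  · rcases (h.cover.2 u v huv).eq_or_lt with he | hlt
    · have := mul_nonneg hc.le (htight u v ⟨huv, he⟩)
      linarith
    · have := hδw (u, v) (by simpa using hlt)
      dsimp only at this
      nlinarith [hge u, hge v]
  · have hvr : v ≠ r := fun e => hv (by rw [e, hμr])
    refine ⟨(h.tight v hv).1, ?_⟩
    rw [(h.tight v hv).2]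
    linear_combination - c * hneg v hvr
  · have hC0 : ∀ x ∈ s(u, v), f x = 0 := fun x hx => by
      have hxC : x ∈ edgeVerts C := ⟨_, huv, hx⟩
      exact hzero x (fun e => hrF C hC (e ▸ hxC)) (h.fixed C hC x hxC)
    rw [h.cycle_tight C hC u v huv, hC0 u (by simp), hC0 v (by simp)]
    ring
  · have hvr : v ≠ r := fun e => h3 (e ▸ hr)
    simp [h.exposed v h1 h2 h3, hzero v hvr h1]
  · simp only [coverValue, Finset.sum_add_distrib, ← Finset.mul_sum, hsum]
    linarith

theorem TightState.isClosed (h : TightState G w y μ F R) :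
    IsClosed {z : V → ℝ | TightState G w z μ F R} := by
  have heq : {z : V → ℝ | TightState G w z μ F R} = {z | (∀ v, 0 ≤ z v) ∧
      (∀ u v, G.Adj u v → w s(u, v) ≤ z u + z v) ∧
      (∀ v, μ v ≠ v → w s(v, μ v) = z v + z (μ v)) ∧
      (∀ C ∈ F, ∀ u v, s(u, v) ∈ C → w s(u, v) = z u + z v) ∧
      ∀ v, μ v = v → (∀ C ∈ F, v ∉ edgeVerts C) → v ∉ R → z v = 0} := by
    ext z
    constructor
    · exact fun hz => ⟨hz.cover.1, hz.cover.2, fun v hv => (hz.tight v hv).2, hz.cycle_tight,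
        hz.exposed⟩
    · exact fun ⟨h1, h2, h3, h4, h5⟩ => ⟨⟨h1, h2⟩, h.invol, fun v hv => ⟨(h.tight v hv).1, h3 v hv⟩,
        h.isCycle, h4, h.disjoint, h.fixed, h5⟩
  rw [heq]
  simp only [Set.ofPred_and, Set.ofPred_forall]
  refine .inter ?_ (.inter ?_ (.inter ?_ (.inter ?_ ?_))) <;>
    repeat' refine isClosed_iInter fun _ => ?_
  · exact isClosed_le (by fun_prop) (by fun_prop)
  · exact isClosed_le (by fun_prop) (by fun_prop)
  · exact isClosed_eq (by fun_prop) (by fun_prop)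
  · exact isClosed_eq (by fun_prop) (by fun_prop)
  · exact isClosed_eq (by fun_prop) (by fun_prop)

theorem TightState.exists_forall_coverValue_le (h : TightState G w y μ F R) :
    ∃ z, TightState G w z μ F R ∧ ∀ z', TightState G w z' μ F R → coverValue z ≤ coverValue z' := by
  have hcont : Continuous (coverValue : (V → ℝ) → ℝ) := by
    unfold coverValue
    fun_prop
  have hK : IsCompact ({z | TightState G w z μ F R} ∩ {z | coverValue z ≤ coverValue y}) := by
    refine (isCompact_univ_pi fun _ => isCompact_Icc (a := 0) (b := coverValue y)).of_isClosed_subset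
      (h.isClosed.inter (isClosed_le hcont continuous_const)) fun z hz v _ => ⟨hz.1.cover.1 v, ?_⟩
    exact (Finset.single_le_sum (fun v _ => hz.1.cover.1 v) (Finset.mem_univ v)).trans hz.2
  obtain ⟨z, hz, hmin⟩ := hK.exists_isMinOn ⟨y, h, le_refl (coverValue y)⟩ hcont.continuousOn
  refine ⟨z, hz.1, fun z' hz' => ?_⟩
  by_cases hle : coverValue z' ≤ coverValue y
  · exact hmin ⟨hz', hle⟩
  · exact hz.2.trans (not_le.1 hle).le

theorem TightState.exists_empty (h : TightState G w y μ F R) :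
    ∃ y' μ' F', TightState G w y' μ' F' ∅ ∧ F'.card ≤ F.card + R.card := by
  induction hn : R.card using Nat.strong_induction_on generalizing y μ F R with
  | _ n ih =>
    rcases R.eq_empty_or_nonempty with rfl | ⟨r, hr⟩
    · exact ⟨y, μ, F, h, by omega⟩
    · obtain ⟨z, hz, hmin⟩ := h.exists_forall_coverValue_le
      have hI : Improvable G w z F R := by
        by_cases hfree : μ r = r ∧ ∀ C ∈ F, r ∉ edgeVerts C
        · by_contra hI
          obtain ⟨z', hz', hlt⟩ := hz.exists_coverValue_lt hr hfree.1 hfree.2 hI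
          exact (hmin z' hz').not_gt hlt
        · refine .of_erase (μ := μ) hr { hz with exposed := fun v h1 h2 h3 => ?_ } (Nat.le_succ _)
          exact hz.exposed v h1 h2 fun hv =>
            h3 (Finset.mem_erase.2 ⟨fun e => hfree (e ▸ ⟨h1, h2⟩), hv⟩)
      obtain ⟨μ', F', R', h1, h2, h3⟩ := hI
      obtain ⟨y', μ'', F'', h4, h5⟩ := ih R'.card (hn ▸ h2) h1 rfl
      exact ⟨y', μ'', F'', h4, by omega⟩

end Extremal

section Matching

set_option linter.unusedSectionVars false

variable {w x : Sym2 V → ℝ} {y : V → ℝ} {μ : V → V} {F : Finset (Finset (Sym2 V))} {R : Finset V}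
  {M : Finset (Sym2 V)}

/-- The edges matched by an involution. -/
def matchingEdges (μ : V → V) : Finset (Sym2 V) :=
  (Finset.univ.filter fun v => μ v ≠ v).image fun v => s(v, μ v)

theorem mem_matchingEdges (hμ : ∀ v, μ (μ v) = v) {u v : V} :
    s(u, v) ∈ matchingEdges μ ↔ μ u = v ∧ u ≠ v := by
  simp only [matchingEdges, Finset.mem_image, Finset.mem_filter, Finset.mem_univ, true_and]
  constructor
  · rintro ⟨a, ha, he⟩
    rcases Sym2.eq_iff.1 he with ⟨rfl, rfl⟩ | ⟨rfl, rfl⟩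
    · exact ⟨rfl, ha.symm⟩
    · exact ⟨hμ _, ha⟩
  · rintro ⟨rfl, h⟩
    exact ⟨u, h.symm, rfl⟩

theorem TightState.isMatching_matchingEdges (h : TightState G w y μ F R) {S : Set V}
    (hS : ∀ v ∈ S, μ v = v) : IsMatching (deleteVerts G S) (matchingEdges μ) := by
  have hS' : ∀ v, μ v ≠ v → v ∉ S := fun v hv hvS => hv (hS v hvS)
  have hmem : ∀ e ∈ matchingEdges μ, ∀ v ∈ e, e = s(v, μ v) ∧ μ v ≠ v := by
    intro e he v hv
    obtain ⟨u, rfl⟩ := hv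
    obtain ⟨rfl, h2⟩ := (mem_matchingEdges h.invol).1 he
    exact ⟨rfl, h2.symm⟩
  refine ⟨fun e he => ?_, fun e he f hf hef v hve hvf => hef ?_⟩
  · induction e with
    | _ u v =>
      obtain ⟨h1, h2⟩ := hmem _ he u (by simp)
      rw [h1]
      refine ⟨(h.tight u h2).1, hS' u h2, hS' _ ?_⟩
      rw [h.invol]
      exact h2.symm
  · rw [(hmem e he v hve).1, (hmem f hf v hvf).1]

theorem setWeight_eq_fracWeight (w : Sym2 V → ℝ) (M : Finset (Sym2 V)) :
    setWeight w M = fracWeight w fun e => if e ∈ M then 1 else 0 := by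
  simp [setWeight, fracWeight]

theorem IsMatching.isFracMatching (hM : IsMatching G M) :
    IsFracMatching G fun e => if e ∈ M then 1 else 0 := by
  refine ⟨fun e => by dsimp only; split_ifs <;> norm_num, fun e he => if_neg fun h => he (hM.1 h),
    fun v => ?_⟩
  rw [Finset.sum_boole]
  norm_cast
  refine Finset.card_le_one.2 fun a ha b hb => ?_
  simp only [Finset.mem_filter, Finset.mem_univ, true_and] at ha hb
  by_contra hab
  exact hM.2 _ ha _ hb (fun h => hab (Sym2.congr_right.1 h)) v (by simp) (by simp)

theorem exists_setWeight_eq_nu (G : SimpleGraph V) (w : Sym2 V → ℝ) :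
    ∃ M, IsMatching G M ∧ setWeight w M = nu G w ∧
      ∀ M', IsMatching G M' → setWeight w M' ≤ nu G w := by
  have hfin : {r : ℝ | ∃ M, IsMatching G M ∧ r = setWeight w M}.Finite :=
    (Set.finite_range (setWeight w)).subset fun r ⟨M, _, hr⟩ => ⟨M, hr.symm⟩
  have hne : {r : ℝ | ∃ M, IsMatching G M ∧ r = setWeight w M}.Nonempty :=
    ⟨_, ∅, ⟨by simp, by simp⟩, rfl⟩
  obtain ⟨M, hM, h⟩ := hne.csSup_mem hfin
  exact ⟨M, hM, h.symm, fun M' hM' => le_csSup hfin.bddAbove ⟨M', hM', rfl⟩⟩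

theorem nu_le_nuf (hw : ∀ e, 0 ≤ w e) : nu G w ≤ nuf G w := by
  obtain ⟨M, hM, h, -⟩ := exists_setWeight_eq_nu G w
  rw [← h, setWeight_eq_fracWeight]
  exact fracWeight_le_nuf hw hM.isFracMatching

/-- The half-integral vector of a matching and a family of odd cycles. -/
noncomputable def halfVec (μ : V → V) (F : Finset (Finset (Sym2 V))) (e : Sym2 V) : ℝ :=
  if ∃ C ∈ F, e ∈ C then 1 / 2 else if e ∈ matchingEdges μ then 1 else 0

namespace TightState

theorem halfVec_of_mem (h : TightState G w y μ F R) {C : Finset (Sym2 V)} (hC : C ∈ F) {v : V}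
    (hv : v ∈ edgeVerts C) (u : V) :
    halfVec μ F s(v, u) = if s(v, u) ∈ C then 1 / 2 else 0 := by
  have h1 : (∃ D ∈ F, s(v, u) ∈ D) ↔ s(v, u) ∈ C := by
    refine ⟨fun ⟨D, hD, hvD⟩ => ?_, fun hvC => ⟨C, hC, hvC⟩⟩
    by_cases hDC : D = C
    · rwa [← hDC]
    · exact (Set.disjoint_left.1 (h.disjoint D hD C hC hDC) ⟨_, hvD, by simp⟩ hv).elim
  have h2 : s(v, u) ∉ matchingEdges μ := by
    rw [mem_matchingEdges h.invol, h.fixed C hC v hv]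
    exact fun h => h.2 h.1
  simp [halfVec, h1, h2]

theorem halfVec_of_notMem (h : TightState G w y μ F R) {v : V} (hv : ∀ C ∈ F, v ∉ edgeVerts C)
    (u : V) : halfVec μ F s(v, u) = if μ v = u ∧ v ≠ u then 1 else 0 := by
  have h1 : ¬ ∃ D ∈ F, s(v, u) ∈ D := fun ⟨D, hD, hvD⟩ => hv D hD ⟨_, hvD, by simp⟩
  rw [halfVec, if_neg h1]
  exact if_congr (mem_matchingEdges h.invol) rfl rfl

theorem sum_halfVec (h : TightState G w y μ F R) (v : V) :
    (∑ u, halfVec μ F s(v, u) = 1) ∨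
      (μ v = v ∧ (∀ C ∈ F, v ∉ edgeVerts C) ∧ ∑ u, halfVec μ F s(v, u) = 0) := by
  by_cases hv : ∀ C ∈ F, v ∉ edgeVerts C
  · simp only [h.halfVec_of_notMem hv]
    by_cases hvv : μ v = v
    · refine .inr ⟨hvv, hv, Finset.sum_eq_zero fun u _ => if_neg ?_⟩
      rw [hvv]
      exact fun h => h.2 h.1
    · left
      rw [Finset.sum_eq_single (μ v) (fun u _ hu => if_neg fun h => hu h.1.symm) (by simp)]
      simp [Ne.symm hvv]
  · push Not at hv
    obtain ⟨C, hC, hvC⟩ := hv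
    left
    simp only [h.halfVec_of_mem hC hvC]
    exact (h.isCycle C hC).sum_eq hvC

theorem halfVec_tight (h : TightState G w y μ F R) {u v : V} (huv : halfVec μ F s(u, v) ≠ 0) :
    TightAdj G w y u v := by
  rw [halfVec] at huv
  split_ifs at huv with h1 h2
  · obtain ⟨C, hC, hCe⟩ := h1
    exact ⟨(h.isCycle C hC).subset_edgeSet hCe, h.cycle_tight C hC u v hCe⟩
  · obtain ⟨rfl, h3⟩ := (mem_matchingEdges h.invol).1 h2
    exact h.tight u h3.symm
  · exact absurd rfl huv

theorem isFracMatching_halfVec (h : TightState G w y μ F R) : IsFracMatching G (halfVec μ F) := by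
  refine ⟨fun e => ?_, fun e he => ?_, fun v => ?_⟩
  · rw [halfVec]
    split_ifs <;> norm_num
  · induction e with
    | _ u v =>
      by_contra h0
      exact he (h.halfVec_tight h0).1
  · rcases h.sum_halfVec v with h1 | ⟨-, -, h1⟩ <;> rw [h1]
    exact zero_le_one

theorem fracWeight_halfVec (h : TightState G w y μ F R) :
    fracWeight w (halfVec μ F) = ∑ v, y v * ∑ u, halfVec μ F s(v, u) := by
  have h1 := slack_identity w _ y h.isFracMatching_halfVec.diag
  rw [Finset.sum_eq_zero fun v _ => Finset.sum_eq_zero fun u _ => ?_] at h1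
  · linarith
  · by_cases h0 : halfVec μ F s(v, u) = 0
    · rw [h0, mul_zero]
    · rw [(h.halfVec_tight h0).2, sub_self, zero_mul]

theorem coverValue_le_fracWeight (h : TightState G w y μ F ∅) :
    coverValue y ≤ fracWeight w (halfVec μ F) := by
  rw [h.fracWeight_halfVec]
  refine Finset.sum_le_sum fun v _ => ?_
  rcases h.sum_halfVec v with h1 | ⟨h1, h2, -⟩
  · rw [h1, mul_one]
  · simp [h.exposed v h1 h2]

theorem exists_isCycleFamily (h : TightState G w y μ F ∅) :
    ∃ x F', IsMaxFracMatching G w x ∧ IsHalfIntegral x ∧ IsCycleFamily G x F' ∧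
      F'.card = F.card := by
  have hle := h.coverValue_le_fracWeight
  refine ⟨halfVec μ F, F, ⟨h.isFracMatching_halfVec, fun z hz =>
    (fracWeight_le_coverValue hz h.cover).trans hle⟩, fun e => ?_, ⟨h.isCycle, h.disjoint,
    fun e => ?_⟩, rfl⟩
  · rw [halfVec]
    split_ifs <;> simp
  · rw [halfVec]
    split_ifs with h1 h2
    · simp [h1]
    · simp only [h1, iff_false]
      norm_num
    · simp [h1]

end TightState

/-- A basic maximum fractional matching and an optimal cover form a tight state. -/
theorem exists_tightState (hx : IsFracMatching G x) (hx2 : IsHalfIntegral x)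
    (hF : IsCycleFamily G x F) (hy : IsFracCover G w y) (hle : coverValue y ≤ fracWeight w x) :
    ∃ μ, TightState G w y μ F ∅ := by
  classical
  obtain ⟨hc1, hc2⟩ := complementary_slackness hx hy hle
  have huniq : ∀ v u u', x s(v, u) = 1 → x s(v, u') ≠ 0 → u = u' := by
    intro v u u' h1 h2
    by_contra hne
    have h3 : x s(v, u) + x s(v, u') ≤ ∑ a, x s(v, a) := by
      rw [← Finset.sum_pair hne (f := fun a => x s(v, a))]
      exact Finset.sum_le_univ_sum_of_nonneg fun a => hx.1 _
    have h4 := hx.2.2 v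
    have h5 := lt_of_le_of_ne (hx.1 s(v, u')) h2.symm
    linarith
  let μ : V → V := fun v => if h : ∃ u, x s(v, u) = 1 then h.choose else v
  have hμ1 : ∀ v u, x s(v, u) = 1 → μ v = u := fun v u hu => by
    have h : ∃ u, x s(v, u) = 1 := ⟨u, hu⟩
    simp only [μ, dif_pos h]
    exact huniq v _ u h.choose_spec (by rw [hu]; exact one_ne_zero)
  have hμ2 : ∀ v, μ v = v ∨ x s(v, μ v) = 1 := fun v => by
    by_cases h : ∃ u, x s(v, u) = 1
    · right
      simp only [μ, dif_pos h]
      exact h.choose_spec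
    · left
      simp [μ, h]
  have hcyc : ∀ C ∈ F, ∀ v ∈ edgeVerts C, ∃ u, x s(v, u) = 1 / 2 := by
    rintro C hC v ⟨e, he, hve⟩
    obtain ⟨u, rfl⟩ := hve
    exact ⟨u, (hF.2.2 _).2 ⟨C, hC, he⟩⟩
  refine ⟨μ, hy, fun v => ?_, fun v hv => ?_, hF.1, fun C hC u v huv => hc1 u v ?_, hF.2.1,
    fun C hC v hv => ?_, fun v h1 h2 _ => ?_⟩
  · rcases hμ2 v with h | h
    · rw [h, h]
    · exact hμ1 _ _ (by rwa [Sym2.eq_swap])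
  · have h1 := (hμ2 v).resolve_left hv
    have h0 : x s(v, μ v) ≠ 0 := by rw [h1]; exact one_ne_zero
    refine ⟨?_, hc1 _ _ h0⟩
    by_contra hadj
    exact h0 (hx.2.1 _ hadj)
  · rw [(hF.2.2 _).2 ⟨C, hC, huv⟩]
    norm_num
  · by_contra hne
    obtain ⟨u, hu⟩ := hcyc C hC v hv
    have h1 := (hμ2 v).resolve_left hne
    rw [huniq v _ u h1 (by rw [hu]; norm_num), hu] at h1
    norm_num at h1
  · by_contra hy0
    have h3 := hc2 v hy0
    rw [Finset.sum_eq_zero fun u _ => ?_] at h3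
    · exact zero_ne_one h3
    · rcases hx2 s(v, u) with h0 | h0 | h0
      · exact h0
      · obtain ⟨C, hC, he⟩ := (hF.2.2 _).1 h0
        exact absurd ⟨_, he, by simp⟩ (h2 C hC)
      · have := hμ1 v u h0
        rw [h1] at this
        subst this
        exact hx.diag v

end Matching

section Deletion

set_option linter.unusedSectionVars false

variable {w : Sym2 V → ℝ} {y : V → ℝ} {μ : V → V} {F : Finset (Finset (Sym2 V))} {S : Finset V}

theorem IsStable.exists_tightState (hw : ∀ e, 0 ≤ w e) (hS : IsStable (deleteVerts G ↑S) w) :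
    ∃ y μ F, TightState G w y μ F ∅ ∧ F.card ≤ S.card := by
  obtain ⟨M, hM, hMw, -⟩ := exists_setWeight_eq_nu (deleteVerts G ↑S) w
  obtain ⟨y, hy, hle⟩ := exists_fracCover_le_nuf (deleteVerts G ↑S) hw
  rw [← hS, ← hMw, setWeight_eq_fracWeight] at hle
  obtain ⟨μ, h⟩ := Stabilizer.exists_tightState (F := ∅) hM.isFracMatching
    (fun e => by by_cases he : e ∈ M <;> simp [he])
    ⟨by simp, by simp, fun e => by by_cases he : e ∈ M <;> simp [he]⟩ hy hle
  have h0 : 0 ≤ ∑ e, w e := Finset.sum_nonneg fun e _ => hw e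
  have h1 : ∀ e, w e ≤ ∑ e, w e := fun e =>
    Finset.single_le_sum (fun e _ => hw e) (Finset.mem_univ e)
  let z : V → ℝ := fun v => if v ∈ S then ∑ e, w e else y v
  have hz : ∀ v, 0 ≤ z v := fun v => by
    simp only [z]
    split_ifs
    exacts [h0, hy.1 v]
  have hzS : ∀ v ∈ S, z v = ∑ e, w e := fun v hv => by simp [z, hv]
  have hzy : ∀ v ∉ S, z v = y v := fun v hv => by simp [z, hv]
  have hG : TightState G w z μ ∅ S := by
    refine ⟨⟨hz, fun u v huv => ?_⟩, h.invol, fun v hv => ?_, by simp, by simp, by simp, by simp,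
      fun v h2 h3 h4 => ?_⟩
    · by_cases hu : u ∈ S
      · linarith [h1 s(u, v), hzS u hu, hz v]
      by_cases hv : v ∈ S
      · linarith [h1 s(u, v), hzS v hv, hz u]
      · rw [hzy u hu, hzy v hv]
        exact hy.2 u v ⟨huv, by simpa using hu, by simpa using hv⟩
    · obtain ⟨⟨h2, h3, h4⟩, h5⟩ := h.tight v hv
      refine ⟨h2, ?_⟩
      rw [hzy v (by simpa using h3), hzy _ (by simpa using h4), h5]
    · rw [hzy v h4]
      exact h.exposed v h2 h3 (by simp)
  obtain ⟨y', μ', F', h2, h3⟩ := hG.exists_empty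
  exact ⟨y', μ', F', h2, by simpa using h3⟩

theorem TightState.isStable_deleteVerts (hw : ∀ e, 0 ≤ w e) (h : TightState G w y μ ∅ S)
    (hS : ∀ v ∈ S, μ v = v) :
    IsStable (deleteVerts G ↑S) w ∧ coverValue y - ∑ v ∈ S, y v ≤ nu (deleteVerts G ↑S) w := by
  let z : V → ℝ := fun v => if v ∈ S then 0 else y v
  have hz : IsFracCover (deleteVerts G ↑S) w z := by
    refine ⟨fun v => ?_, fun u v ⟨huv, hu, hv⟩ => ?_⟩
    · simp only [z]
      split_ifs
      exacts [le_rfl, h.cover.1 v]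
    · rw [Finset.mem_coe] at hu hv
      simpa [z, hu, hv] using h.cover.2 u v huv
  have hzval : coverValue z = coverValue y - ∑ v ∈ S, y v := by
    have h1 : ∀ v, z v = y v - if v ∈ S then y v else 0 := fun v => by
      simp only [z]
      split_ifs <;> simp
    simp [coverValue, h1]
  have hM := h.isMatching_matchingEdges (S := ↑S) hS
  have hzM : coverValue z ≤ setWeight w (matchingEdges μ) := by
    have h1 : (fun e => if e ∈ matchingEdges μ then 1 else 0) = halfVec μ ∅ := by
      funext e
      simp [halfVec]
    rw [setWeight_eq_fracWeight, h1, h.fracWeight_halfVec]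
    refine Finset.sum_le_sum fun v _ => ?_
    by_cases hv : v ∈ S
    · simp only [z, hv, if_true]
      exact mul_nonneg (h.cover.1 v)
        (Finset.sum_nonneg fun u _ => h.isFracMatching_halfVec.1 _)
    · simp only [z, hv, if_false]
      rcases h.sum_halfVec v with h2 | ⟨h2, h3, -⟩
      · rw [h2, mul_one]
      · simp [h.exposed v h2 h3 hv]
  obtain ⟨-, -, -, hmax⟩ := exists_setWeight_eq_nu (deleteVerts G ↑S) w
  have h1 := hzM.trans (hmax _ hM)
  exact ⟨(nu_le_nuf hw).antisymm ((nuf_le_coverValue hz).trans h1), hzval ▸ h1⟩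

/-- Rounding every odd cycle at a cheapest vertex. -/
theorem TightState.exists_round (h : TightState G w y μ F ∅) :
    ∃ (S : Finset V) (μ' : V → V), S.card = F.card ∧ TightState G w y μ' ∅ S ∧
      (∀ v ∈ S, μ' v = v) ∧ 3 * ∑ v ∈ S, y v ≤ coverValue y := by
  classical
  rcases F.eq_empty_or_nonempty with rfl | ⟨C₀, hC₀⟩
  · exact ⟨∅, μ, rfl, h, by simp, by simpa [coverValue] using Finset.sum_nonneg fun v _ => h.cover.1 v⟩
  have : Nonempty V := ⟨(h.isCycle C₀ hC₀).nonempty.some⟩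
  have hmin : ∀ C ∈ F, ∃ a ∈ edgeVerts C, ∀ v ∈ edgeVerts C, y a ≤ y v := fun C hC =>
    (edgeVerts C).toFinite.exists_minimalFor y _ (h.isCycle C hC).nonempty |>.imp fun a ha =>
      ⟨ha.1, fun v hv => (le_total (y a) (y v)).elim id fun hle => ha.2 hv hle⟩
  choose! a ha hamin using hmin
  obtain ⟨μ', h1, h2, -⟩ := h.round_all a ha
  have hinj : Set.InjOn a F := fun C hC D hD hCD => by
    by_contra hne
    exact Set.disjoint_left.1 (h.disjoint C hC D hD hne) (ha C hC) (hCD ▸ ha D hD)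
  refine ⟨F.image a, μ', Finset.card_image_of_injOn hinj, by simpa using h1, by simpa using h2, ?_⟩
  let T : Finset (Sym2 V) → Finset V := fun C => Finset.univ.filter fun v => v ∈ edgeVerts C
  have hT : ∀ C ∈ F, 3 * y (a C) ≤ ∑ v ∈ T C, y v := fun C hC => by
    have h3 : (3 : ℝ) ≤ (T C).card := by
      exact_mod_cast (h.isCycle C hC).three_le (T C) fun v hv => by simpa [T] using hv
    have h4 := Finset.card_nsmul_le_sum (T C) y (y (a C)) fun v hv =>
      hamin C hC v (by simpa [T] using hv)
    rw [nsmul_eq_mul] at h4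
    exact (mul_le_mul_of_nonneg_right h3 (h.cover.1 _)).trans h4
  calc 3 * ∑ v ∈ F.image a, y v = ∑ C ∈ F, 3 * y (a C) := by
        rw [Finset.sum_image hinj, Finset.mul_sum]
    _ ≤ ∑ C ∈ F, ∑ v ∈ T C, y v := Finset.sum_le_sum hT
    _ = ∑ v ∈ F.biUnion T, y v := by
        refine (Finset.sum_biUnion fun C hC D hD hne =>
          Finset.disjoint_left.2 fun v hv hv' => ?_).symm
        simp only [T, Finset.mem_filter, Finset.mem_univ, true_and] at hv hv'
        exact Set.disjoint_left.1 (h.disjoint C hC D hD hne) hv hv'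
    _ ≤ coverValue y := Finset.sum_le_univ_sum_of_nonneg h.cover.1

theorem exists_tightState_card_eq_gamma (G : SimpleGraph V) (hw : ∀ e, 0 ≤ w e) :
    ∃ y μ F, TightState G w y μ F ∅ ∧ F.card = gamma G w := by
  obtain ⟨y₀, hy₀⟩ := exists_fracCover G hw
  have h₀ : TightState G w y₀ id ∅ Finset.univ :=
    ⟨hy₀, by simp, by simp, by simp, by simp, by simp, by simp, by simp⟩
  obtain ⟨y₁, μ₁, F₁, h₁, -⟩ := h₀.exists_empty
  obtain ⟨x₁, F₂, hx₁⟩ := h₁.exists_isCycleFamily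
  obtain ⟨x, F, ⟨hx, hmax⟩, hhalf, hF, hcard⟩ := Nat.sInf_mem (s := {n : ℕ |
    ∃ (x : Sym2 V → ℝ) (F : Finset (Finset (Sym2 V))), IsMaxFracMatching G w x ∧
      IsHalfIntegral x ∧ IsCycleFamily G x F ∧ F.card = n}) ⟨_, x₁, F₂, hx₁⟩
  obtain ⟨y, hy, hle⟩ := exists_fracCover_le_nuf G hw
  have hnuf : nuf G w ≤ fracWeight w x := by
    refine csSup_le ⟨_, x, hx, rfl⟩ ?_
    rintro _ ⟨z, hz, rfl⟩
    exact hmax z hz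
  obtain ⟨μ, h⟩ := exists_tightState hx hhalf hF hy (hle.trans hnuf)
  exact ⟨y, μ, F, h, hcard⟩

end Deletion

/-- every weighted graph admits a vertex-stabilizer of cardinality
exactly γ(G) (hence minimum) which preserves at least 2/3 of ν(G). -/
theorem exists_min_vertexStabilizer
    {V : Type*} [Fintype V] [DecidableEq V]
    (G : SimpleGraph V) (w : Sym2 V → ℝ) (hw : ∀ e, 0 ≤ w e) :
    ∃ S : Finset V, IsStable (deleteVerts G ↑S) w ∧ S.card = gamma G w ∧
      (∀ S' : Finset V, IsStable (deleteVerts G ↑S') w → S.card ≤ S'.card) ∧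
      2 / 3 * nu G w ≤ nu (deleteVerts G ↑S) w := by
  obtain ⟨y, μ, F, h, hF⟩ := exists_tightState_card_eq_gamma G hw
  obtain ⟨S, μ', hSF, hS, hfix, hle⟩ := h.exists_round
  obtain ⟨hstab, hval⟩ := hS.isStable_deleteVerts hw hfix
  refine ⟨S, hstab, hSF.trans hF, fun S' hS' => ?_, ?_⟩
  · obtain ⟨y', μ'', F', h', hF'⟩ := hS'.exists_tightState hw
    exact (hSF.trans hF).le.trans ((Nat.sInf_le h'.exists_isCycleFamily).trans hF')
  · have := (nu_le_nuf hw).trans (nuf_le_coverValue h.cover)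
    linarith

end Stabilizer
end

section
/- For every ε with 0 < ε < 1, the weighted graph G on four vertices {v1, v2, v3, v4} whose edges are the triangle v1v2, v1v3, v2v3 each of weight 2 and the pendant edge v1v4 of weight 1−ε satisfies: ν(G) = 3−ε, G is not stable, and every vertex-stabilizer S of G satisfies ν(G∖S) ≤ 2 = (2/(3−ε))·ν(G). -/
namespace Stabilizer

variable {V : Type*} [Fintype V] [DecidableEq V]

variable {G : SimpleGraph V}

/-- The flower graph of Figure 8: a triangle v0 v1 v2 with a pendant edge v0 v3. -/
def flowerGraph : SimpleGraph (Fin 4) :=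
  SimpleGraph.fromEdgeSet
    {s((0 : Fin 4), (1 : Fin 4)), s((0 : Fin 4), (2 : Fin 4)),
     s((1 : Fin 4), (2 : Fin 4)), s((0 : Fin 4), (3 : Fin 4))}

theorem IsMatching.isFracMatching_indicator {M : Finset (Sym2 V)} (hM : IsMatching G M) :
    IsFracMatching G fun e => if e ∈ M then (1 : ℝ) else 0 := by
  refine ⟨fun e => by positivity, fun e he => if_neg fun h => he (hM.1 h), fun v => ?_⟩
  rw [Finset.sum_boole]
  have hcard : (Finset.univ.filter fun u => s(v, u) ∈ M).card ≤ 1 := by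
    refine Finset.card_le_one.2 fun a ha b hb => ?_
    rw [Finset.mem_filter] at ha hb
    by_contra hab
    exact hM.2 _ ha.2 _ hb.2 (fun h => hab (Sym2.congr_right.1 h)) v (Sym2.mem_mk_left v a)
      (Sym2.mem_mk_left v b)
  exact_mod_cast hcard

theorem setWeight_eq_fracWeight_indicator (w : Sym2 V → ℝ) (M : Finset (Sym2 V)) :
    setWeight w M = fracWeight w fun e => if e ∈ M then (1 : ℝ) else 0 := by
  simp [setWeight, fracWeight]

theorem IsFracMatching.mono {H : SimpleGraph V} (hHG : H ≤ G) {x : Sym2 V → ℝ}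
    (hx : IsFracMatching H x) : IsFracMatching G x :=
  ⟨hx.1, fun e he => hx.2.1 e fun h => he (SimpleGraph.edgeSet_mono hHG h), hx.2.2⟩

theorem nu_le {w : Sym2 V → ℝ} {c : ℝ} (h : ∀ M, IsMatching G M → setWeight w M ≤ c) :
    nu G w ≤ c := by
  refine csSup_le ⟨_, ∅, ⟨by simp, by simp⟩, rfl⟩ ?_
  rintro r ⟨M, hM, rfl⟩
  exact h M hM

theorem deleteVerts_le (G : SimpleGraph V) (S : Set V) : deleteVerts G S ≤ G :=
  fun _ _ h => h.1

theorem deleteVerts_empty (G : SimpleGraph V) : deleteVerts G ∅ = G := by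
  ext a b
  simp [deleteVerts]

theorem IsFracMatching.apply_eq_zero_of_mem {S : Set V} {x : Sym2 V → ℝ}
    (hx : IsFracMatching (deleteVerts G S) x) {a b : V} (h : a ∈ S ∨ b ∈ S) : x s(a, b) = 0 :=
  hx.2.1 _ fun hab => h.elim hab.2.1 hab.2.2

theorem IsFracMatching.fracWeight_flowerGraph {x : Sym2 (Fin 4) → ℝ}
    (hx : IsFracMatching flowerGraph x) (w : Sym2 (Fin 4) → ℝ) :
    fracWeight w x = w s(0, 1) * x s(0, 1) + w s(0, 2) * x s(0, 2) +
      w s(1, 2) * x s(1, 2) + w s(0, 3) * x s(0, 3) := by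
  have h : fracWeight w x = ∑ e ∈ ({s(0, 1), s(0, 2), s(1, 2), s(0, 3)} : Finset (Sym2 (Fin 4))),
      w e * x e := by
    refine (Finset.sum_subset (Finset.subset_univ _) fun e _ he => ?_).symm
    rw [hx.2.1 e, mul_zero]
    intro h
    rw [flowerGraph, SimpleGraph.edgeSet_fromEdgeSet] at h
    exact he (by simpa using h.1)
  rw [h, Finset.sum_insert (by decide), Finset.sum_insert (by decide),
    Finset.sum_insert (by decide), Finset.sum_singleton]
  ring

theorem IsFracMatching.degree_le_flowerGraph {x : Sym2 (Fin 4) → ℝ}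
    (hx : IsFracMatching flowerGraph x) :
    x s(0, 1) + x s(0, 2) + x s(0, 3) ≤ 1 ∧ x s(0, 1) + x s(1, 2) ≤ 1 ∧
      x s(0, 2) + x s(1, 2) ≤ 1 := by
  have h0 := hx.2.2 0
  have h1 := hx.2.2 1
  have h2 := hx.2.2 2
  rw [Fin.sum_univ_four] at h0 h1 h2
  rw [Sym2.eq_swap (a := 1) (b := 0)] at h1
  rw [Sym2.eq_swap (a := 2) (b := 0), Sym2.eq_swap (a := 2) (b := 1)] at h2
  have := hx.1
  refine ⟨?_, ?_, ?_⟩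
  · linarith [this s(0, 0)]
  · linarith [this s(1, 1), this s(1, 3)]
  · linarith [this s(2, 2), this s(2, 3)]

/-- for 0 < ε < 1, the graph of Figure 8 (triangle edges of weight 2,
pendant edge of weight 1 − ε) satisfies ν(G) = 3 − ε, is unstable, and every
vertex-stabilizer S satisfies ν(G∖S) ≤ 2 = (2/(3−ε))·ν(G). -/
theorem tight_two_thirds (ε : ℝ) (hε0 : 0 < ε) (hε1 : ε < 1)
    (w : Sym2 (Fin 4) → ℝ) (hw : ∀ e, 0 ≤ w e)
    (h01 : w s((0 : Fin 4), (1 : Fin 4)) = 2)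
    (h02 : w s((0 : Fin 4), (2 : Fin 4)) = 2)
    (h12 : w s((1 : Fin 4), (2 : Fin 4)) = 2)
    (h03 : w s((0 : Fin 4), (3 : Fin 4)) = 1 - ε) :
    nu flowerGraph w = 3 - ε ∧ ¬ IsStable flowerGraph w ∧
    ∀ S : Finset (Fin 4), IsStable (deleteVerts flowerGraph ↑S) w →
      nu (deleteVerts flowerGraph ↑S) w ≤ 2 ∧
      (2 : ℝ) = 2 / (3 - ε) * nu flowerGraph w := by
  have hν : nu flowerGraph w = 3 - ε := by
    have hle : ∀ M, IsMatching flowerGraph M → setWeight w M ≤ 3 - ε := by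
      intro M hM
      have hx := hM.isFracMatching_indicator
      rw [setWeight_eq_fracWeight_indicator, hx.fracWeight_flowerGraph, h01, h02, h12, h03]
      obtain ⟨d0, d1, d2⟩ := hx.degree_le_flowerGraph
      split_ifs at * <;> linarith
    refine le_antisymm (nu_le hle) (le_csSup ⟨3 - ε, ?_⟩ ⟨{s(1, 2), s(0, 3)}, ⟨?_, ?_⟩, ?_⟩)
    · rintro r ⟨M, hM, rfl⟩
      exact hle M hM
    · simp [Set.insert_subset_iff, flowerGraph]
    · decide
    · rw [setWeight, Finset.sum_pair (by decide), h12, h03]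
      ring
  have hnuf : 3 ≤ nuf flowerGraph w := by
    refine le_csSup ⟨3, ?_⟩ ?_
    · rintro r ⟨x, hx, rfl⟩
      obtain ⟨d0, d1, d2⟩ := hx.degree_le_flowerGraph
      rw [hx.fracWeight_flowerGraph, h01, h02, h12, h03]
      nlinarith [hx.1 s(0, 3)]
    · have hx : IsFracMatching flowerGraph fun e =>
          if e ∈ ({s(0, 1), s(0, 2), s(1, 2)} : Finset (Sym2 (Fin 4))) then 1 / 2 else 0 := by
        refine ⟨fun e => by positivity, fun e he => if_neg fun h => he ?_, fun v => ?_⟩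
        · simp only [Finset.mem_insert, Finset.mem_singleton] at h
          rcases h with rfl | rfl | rfl <;> simp [flowerGraph]
        · rw [Fin.sum_univ_four]
          fin_cases v <;> simp <;> norm_num
      refine ⟨_, hx, ?_⟩
      rw [hx.fracWeight_flowerGraph, h01, h02, h12, h03]
      simp
      norm_num
  have hns : ¬ IsStable flowerGraph w := fun h => by
    rw [IsStable, hν] at h
    linarith
  refine ⟨hν, hns, fun S hS => ⟨nu_le fun M hM => ?_, ?_⟩⟩
  · obtain ⟨v, hv⟩ : S.Nonempty := by
      rw [Finset.nonempty_iff_ne_empty]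
      rintro rfl
      rw [Finset.coe_empty, deleteVerts_empty] at hS
      exact hns hS
    have hxS := hM.isFracMatching_indicator
    have hx := hxS.mono (deleteVerts_le _ _)
    rw [setWeight_eq_fracWeight_indicator, hx.fracWeight_flowerGraph, h01, h02, h12, h03]
    obtain ⟨d0, d1, d2⟩ := hx.degree_le_flowerGraph
    have hz : ∀ a b, a = v ∨ b = v → (if s(a, b) ∈ M then (1 : ℝ) else 0) = 0 := fun a b h =>
      hxS.apply_eq_zero_of_mem (by rcases h with rfl | rfl <;> simp [hv])
    have z01 := hz 0 1
    have z02 := hz 0 2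
    have z12 := hz 1 2
    have z03 := hz 0 3
    clear hz hx hxS hM hS
    fin_cases v <;> simp at z01 z02 z12 z03 <;> split_ifs at * <;> linarith
  · rw [hν, div_mul_cancel₀]
    linarith

end Stabilizer
end
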